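/- Let c ≥ 1 be a real number and let f be a C^∞ function defined on [x_0, ∞) for some x_0 ≥ 1, with f(x) → ∞ as x → ∞, such that for every ε > 0 and every integer j ≥ 0 there are positive constants A_{j,ε}, B_{j,ε} and a point beyond which A_{j,ε} x^{c−j−ε} ≤ |f^{(j)}(x)| ≤ B_{j,ε} x^{c−j+ε}. Then the sequence (⌊f(n)⌋)_{n} (defined for integers n ≥ x_0) is an asymptotic basis. -/

import Mathlib

open Finset
/-- Forward difference of a real sequence. -/
def seqD (x : ℕ → ℝ) : ℕ → ℝ := fun n => x (n + 1) - x n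

/-- Discrete intermediate value theorem. -/
lemma discrete_ivt (a : ℕ → ℝ) (g : ℝ) (hg : 0 ≤ g) (M : ℕ)
    (hstep : ∀ m < M, |a (m + 1) - a m| ≤ g) (v : ℝ)
    (hv : (a 0 ≤ v ∧ v ≤ a M) ∨ (a M ≤ v ∧ v ≤ a 0)) :
    ∃ m ≤ M, |a m - v| ≤ g := by
  induction M with
  | zero =>
    refine ⟨0, le_rfl, ?_⟩
    have : a 0 = v := by rcases hv with h | h <;> linarith [h.1, h.2]
    simp [this, hg]
  | succ M ih =>
    have hs := abs_le.1 (hstep M (Nat.lt_succ_self M))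
    rcases hv with h | h
    · by_cases h2 : v ≤ a M
      · obtain ⟨m, hm, hm'⟩ := ih (fun m hm => hstep m (by omega)) (Or.inl ⟨h.1, h2⟩)
        exact ⟨m, by omega, hm'⟩
      · push Not at h2
        exact ⟨M + 1, le_rfl, abs_le.2 ⟨by linarith [h.2], by linarith [h.2]⟩⟩
    · by_cases h2 : a M ≤ v
      · obtain ⟨m, hm, hm'⟩ := ih (fun m hm => hstep m (by omega)) (Or.inr ⟨h2, h.2⟩)
        exact ⟨m, by omega, hm'⟩
      · push Not at h2
        exact ⟨M + 1, le_rfl, abs_le.2 ⟨by linarith [h.1], by linarith [h.1]⟩⟩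

lemma drift_bound (a : ℕ → ℝ) (g : ℝ) (W : ℕ) (hstep : ∀ m < W, |a (m + 1) - a m| ≤ g) :
    ∀ s ≤ W, |a s - a 0| ≤ s * g := by
  intro s
  induction s with
  | zero => intro _; simp
  | succ s ih =>
    intro hs
    have h1 := ih (by omega)
    have h2 := hstep s (by omega)
    calc |a (s + 1) - a 0| = |(a (s + 1) - a s) + (a s - a 0)| := by ring_nf
      _ ≤ _ := abs_add_le _ _
      _ ≤ g + s * g := add_le_add h2 h1
      _ = _ := by push_cast; ring

lemma sweep_step_pos (τ η : ℝ) (hη : 0 < η) (W' : ℕ) : ∃ θ0 : ℝ, 0 < θ0 ∧ ∀ θ : ℝ, 0 < θ → θ ≤ θ0 →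
    ∃ W : ℕ, ∀ (y : ℕ → ℝ) (n : ℕ),
      (∀ s ≤ W, ∃ z : ℤ, |y (n + s + 1) - y (n + s) - θ - z| ≤ θ / 2) →
      ∃ n' ≥ n, ∀ s ≤ W', ∃ z : ℤ, |y (n' + s) - τ - z| ≤ η := by
  refine ⟨η / (2 * (W' + 1)), by positivity, fun θ hθ hθ0 => ?_⟩
  refine ⟨⌈2 / θ⌉₊ + W', fun y n h => ?_⟩
  set T := ⌈2 / θ⌉₊ with hT
  have hTθ : 2 ≤ T * θ := by
    have := Nat.le_ceil (2 / θ)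
    rw [div_le_iff₀ hθ] at this
    exact this
  choose! z hz using h
  set Y : ℕ → ℝ := fun s => y (n + s) - ∑ i ∈ Finset.range s, (z i : ℝ) with hY
  have hdiff : ∀ s, Y (s + 1) - Y s = y (n + s + 1) - y (n + s) - z s := by
    intro s
    simp only [hY, Finset.sum_range_succ, ← add_assoc]
    ring
  have hstep : ∀ s ≤ T + W', θ / 2 ≤ Y (s + 1) - Y s ∧ Y (s + 1) - Y s ≤ 3 * θ / 2 := by
    intro s hs
    have := abs_le.1 (hz s hs)
    rw [hdiff]
    constructor <;> linarith [this.1, this.2]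
  have hgrow : ∀ s ≤ T, Y 0 + s * (θ / 2) ≤ Y s := by
    intro s
    induction s with
    | zero => intro _; simp
    | succ s ih =>
      intro hs
      have h1 := ih (by omega)
      have h2 := (hstep s (by omega)).1
      push_cast
      linarith
  have hbig := hgrow T le_rfl
  set w : ℤ := ⌈Y 0 - τ⌉ with hw
  have hw1 := Int.le_ceil (Y 0 - τ)
  have hw2 := Int.ceil_lt_add_one (Y 0 - τ)
  obtain ⟨m, hm, hm'⟩ := discrete_ivt Y (3 * θ / 2) (by positivity) T
    (fun m hm => abs_le.2 ⟨by linarith [(hstep m (by omega)).1], (hstep m (by omega)).2⟩) (τ + w)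
    (Or.inl ⟨by linarith, by nlinarith⟩)
  refine ⟨n + m, by omega, fun s hs => ?_⟩
  have hdr := drift_bound (fun s => Y (m + s)) (3 * θ / 2) W'
    (fun i hi => abs_le.2 ⟨by
        have := (hstep (m + i) (by omega)).1
        rw [add_assoc] at this
        linarith, (hstep (m + i) (by omega)).2⟩) s hs
  refine ⟨w + ∑ i ∈ Finset.range (m + s), z i, ?_⟩
  have e : y (n + m + s) - τ - ((w + ∑ i ∈ Finset.range (m + s), z i : ℤ) : ℝ)
      = (Y (m + s) - Y m) + (Y m - (τ + w)) := by
    simp only [hY]; push_cast; rw [add_assoc n m s]; ring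
  rw [e]
  simp only [add_zero] at hdr
  have hsW : (s : ℝ) ≤ W' := by exact_mod_cast hs
  calc _ ≤ _ := abs_add_le _ _
    _ ≤ s * (3 * θ / 2) + 3 * θ / 2 := add_le_add hdr hm'
    _ ≤ (W' + 1) * (2 * θ) := by nlinarith
    _ ≤ η := by
      rw [le_div_iff₀ (by positivity)] at hθ0
      linarith

lemma sweep_step (τ η : ℝ) (hη : 0 < η) (W' : ℕ) : ∃ θ0 : ℝ, 0 < θ0 ∧ ∀ θ : ℝ, θ ≠ 0 → |θ| ≤ θ0 →
    ∃ W : ℕ, ∀ (y : ℕ → ℝ) (n : ℕ),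
      (∀ s ≤ W, ∃ z : ℤ, |y (n + s + 1) - y (n + s) - θ - z| ≤ |θ| / 2) →
      ∃ n' ≥ n, ∀ s ≤ W', ∃ z : ℤ, |y (n' + s) - τ - z| ≤ η := by
  obtain ⟨a, ha, h1⟩ := sweep_step_pos τ η hη W'
  obtain ⟨b, hb, h2⟩ := sweep_step_pos (-τ) η hη W'
  refine ⟨min a b, lt_min ha hb, fun θ hθ hle => ?_⟩
  rcases lt_or_gt_of_ne hθ with hneg | hpos
  · rw [abs_of_neg hneg] at hle ⊢
    obtain ⟨W, hW⟩ := h2 (-θ) (by linarith) (hle.trans (min_le_right _ _))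
    refine ⟨W, fun y n h => ?_⟩
    obtain ⟨n', hn', h'⟩ := hW (fun i => - y i) n (fun s hs => by
      obtain ⟨z, hz⟩ := h s hs
      refine ⟨-z, ?_⟩
      rw [← abs_neg]
      convert hz using 2
      push_cast; ring)
    refine ⟨n', hn', fun s hs => ?_⟩
    obtain ⟨z, hz⟩ := h' s hs
    refine ⟨-z, ?_⟩
    rw [← abs_neg]
    convert hz using 2
    push_cast; ring
  · rw [abs_of_pos hpos] at hle ⊢
    exact h1 θ hpos (hle.trans (min_le_left _ _))

lemma sweep_chain (k : ℕ) : ∀ (τ η : ℝ), 0 < η → ∃ θ0 : ℝ, 0 < θ0 ∧ ∀ θ : ℝ, θ ≠ 0 → |θ| ≤ θ0 →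
    ∃ W : ℕ, ∀ (x : ℕ → ℝ) (n : ℕ),
      (∀ s ≤ W, ∃ z : ℤ, |seqD^[k + 1] x (n + s) - θ - z| ≤ |θ| / 2) →
      ∃ n' ≥ n, ∃ z : ℤ, |x n' - τ - z| ≤ η := by
  induction k with
  | zero =>
    intro τ η hη
    obtain ⟨θ0, h0, h⟩ := sweep_step τ η hη 0
    refine ⟨θ0, h0, fun θ h1 h2 => ?_⟩
    obtain ⟨W, hW⟩ := h θ h1 h2
    refine ⟨W, fun x n hx => ?_⟩
    obtain ⟨n', hn', h'⟩ := hW x n (by simpa [seqD] using hx)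
    exact ⟨n', hn', by simpa using h' 0 le_rfl⟩
  | succ k ih =>
    intro τ η hη
    obtain ⟨θ1, h1, hc⟩ := ih τ η hη
    obtain ⟨W1, hW1⟩ := hc θ1 h1.ne' (abs_of_pos h1).le
    obtain ⟨θ0, h0, h⟩ := sweep_step θ1 (|θ1| / 2) (by positivity) W1
    refine ⟨θ0, h0, fun θ h1 h2 => ?_⟩
    obtain ⟨W, hW⟩ := h θ h1 h2
    refine ⟨W, fun x n hx => ?_⟩
    obtain ⟨n', hn', h'⟩ := hW (seqD^[k + 1] x) n (by
      intro s hs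
      have := hx s hs
      rw [Function.iterate_succ_apply'] at this
      exact this)
    obtain ⟨n'', hn'', h''⟩ := hW1 x n' h'
    exact ⟨n'', by omega, h''⟩

lemma sweep_top (y : ℕ → ℝ) (p : ℤ)
    (h0 : Filter.Tendsto (fun n => seqD y n) Filter.atTop (nhds (p : ℝ)))
    (h1 : Filter.Tendsto (fun n => |y n - p * n|) Filter.atTop Filter.atTop)
    (τ η : ℝ) (hη : 0 < η) (W n1 : ℕ) :
    ∃ n ≥ n1, ∀ s ≤ W, ∃ z : ℤ, |y (n + s) - τ - z| ≤ η := by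
  set σ := min (η / (W + 1)) 1 with hσ
  have hσ0 : 0 < σ := lt_min (by positivity) one_pos
  obtain ⟨n2, hn2⟩ := (Metric.tendsto_atTop.1 h0) σ hσ0
  set m0 := max n1 n2 with hm0
  set Y : ℕ → ℝ := fun s => y (m0 + s) - p * ((m0 + s : ℕ) : ℝ) with hY
  have hstep : ∀ s, |Y (s + 1) - Y s| ≤ σ := by
    intro s
    have := hn2 (m0 + s) (by omega)
    rw [Real.dist_eq] at this
    have e : Y (s + 1) - Y s = seqD y (m0 + s) - p := by
      simp only [hY, seqD, ← add_assoc]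
      push_cast
      ring
    rw [e]
    exact this.le
  obtain ⟨n3, hn3⟩ := Filter.eventually_atTop.1 (h1.eventually_ge_atTop (|Y 0| + 2))
  have hbig : |Y 0| + 2 ≤ |Y n3| := hn3 (m0 + n3) (by omega)
  have hex : ∃ w : ℤ, (Y 0 ≤ τ + w ∧ τ + w ≤ Y n3) ∨ (Y n3 ≤ τ + w ∧ τ + w ≤ Y 0) := by
    rcases le_total 0 (Y n3) with h | h
    · rw [abs_of_nonneg h] at hbig
      refine ⟨⌈Y 0 - τ⌉, Or.inl ⟨by linarith [Int.le_ceil (Y 0 - τ)], ?_⟩⟩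
      linarith [Int.ceil_lt_add_one (Y 0 - τ), le_abs_self (Y 0)]
    · rw [abs_of_nonpos h] at hbig
      refine ⟨⌊Y 0 - τ⌋, Or.inr ⟨?_, by linarith [Int.floor_le (Y 0 - τ)]⟩⟩
      linarith [Int.lt_floor_add_one (Y 0 - τ), neg_abs_le (Y 0)]
  obtain ⟨w, hw⟩ := hex
  obtain ⟨m, hm, hm'⟩ := discrete_ivt Y σ hσ0.le n3 (fun m _ => hstep m) _ hw
  refine ⟨m0 + m, by omega, fun s hs => ?_⟩
  have hdr := drift_bound (fun s => Y (m + s)) σ W (fun i _ => hstep (m + i)) s hs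
  rw [add_zero] at hdr
  refine ⟨w + p * ((m0 + m + s : ℕ) : ℤ), ?_⟩
  have e : y (m0 + m + s) - τ - ((w + p * ((m0 + m + s : ℕ) : ℤ) : ℤ) : ℝ)
      = (Y (m + s) - Y m) + (Y m - (τ + w)) := by
    simp only [hY]; push_cast; rw [add_assoc m0 m s]; ring
  rw [e]
  have hsW : (s : ℝ) ≤ W := by exact_mod_cast hs
  have hση : σ * (W + 1) ≤ η := by
    have := min_le_left (η / ((W : ℝ) + 1)) 1
    rw [← hσ, le_div_iff₀ (by positivity)] at this
    exact this
  calc _ ≤ _ := abs_add_le _ _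
    _ ≤ s * σ + σ := add_le_add hdr hm'
    _ ≤ σ * (W + 1) := by nlinarith
    _ ≤ η := hση

/-- Combined: if a difference sweeps slowly, then the sequence is dense mod one. -/
lemma sweep_dense (k : ℕ) (x : ℕ → ℝ) (p : ℤ)
    (h0 : Filter.Tendsto (fun n => seqD^[k + 1] x n) Filter.atTop (nhds (p : ℝ)))
    (h1 : Filter.Tendsto (fun n => |seqD^[k] x n - p * n|) Filter.atTop Filter.atTop)
    (τ η : ℝ) (hη : 0 < η) (n1 : ℕ) :
    ∃ n ≥ n1, ∃ z : ℤ, |x n - τ - z| ≤ η := by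
  have h0' : Filter.Tendsto (fun n => seqD (seqD^[k] x) n) Filter.atTop (nhds (p : ℝ)) := by
    simpa only [Function.iterate_succ_apply'] using h0
  rcases k with _ | k
  · obtain ⟨n, hn, h⟩ := sweep_top x p h0' h1 τ η hη 0 n1
    exact ⟨n, hn, by simpa using h 0 le_rfl⟩
  · obtain ⟨θ0, hθ0, hc⟩ := sweep_chain k τ η hη
    obtain ⟨W, hW⟩ := hc θ0 hθ0.ne' (abs_of_pos hθ0).le
    obtain ⟨n, hn, h⟩ := sweep_top (seqD^[k + 1] x) p h0' h1 θ0 (|θ0| / 2) (by positivity) W n1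
    obtain ⟨na, hna, hh⟩ := hW x n h
    exact ⟨na, by omega, hh⟩

/-- Mean value bounds for iterated differences. -/
lemma seqD_mvt (j : ℕ) : ∀ (F : ℕ → ℝ → ℝ) (x0 : ℝ)
    (_ : ∀ i x, x0 < x → HasDerivAt (F i) (F (i + 1) x) x) (q b : ℝ) (_ : 0 < q) (n : ℕ)
    (_ : x0 < q * n + b) (lo hi : ℝ)
    (_ : ∀ ξ, q * n + b ≤ ξ → ξ ≤ q * n + b + j * q → lo ≤ F j ξ ∧ F j ξ ≤ hi),
    lo * q ^ j ≤ seqD^[j] (fun m => F 0 (q * m + b)) n ∧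
    seqD^[j] (fun m => F 0 (q * m + b)) n ≤ hi * q ^ j := by
  induction j with
  | zero =>
    intro F x0 hF q b hq n hn lo hi h
    simpa using h _ le_rfl (by simp)
  | succ j ih =>
    intro F x0 hF q b hq n hn lo hi h
    have e : seqD (fun m => F 0 (q * m + b)) = fun m : ℕ => (fun i x => F i (x + q) - F i x) 0 (q * m + b) := by
      funext m
      simp only [seqD]
      push_cast
      ring_nf
    rw [Function.iterate_succ_apply, e]
    have key := ih (fun i x => F i (x + q) - F i x) x0 (fun i x hx => by
      have h1 := (hF i (x + q) (by linarith)).comp_add_const x q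
      exact h1.sub (hF i x hx)) q b hq n hn (lo * q) (hi * q) (by
      intro ξ h1 h2
      obtain ⟨ζ, hζ, hζ'⟩ := exists_hasDerivAt_eq_slope (F j) (F (j + 1)) (show ξ < ξ + q by linarith)
        (fun t ht => (hF j t (by linarith [ht.1])).continuousAt.continuousWithinAt)
        (fun t ht => hF j t (by linarith [ht.1]))
      have hb := h ζ (by linarith [hζ.1]) (by push_cast; linarith [hζ.2])
      rw [hζ'] at hb
      have e3 : ξ + q - ξ = q := by ring
      rw [e3, le_div_iff₀ hq, div_le_iff₀ hq] at hb
      exact hb)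
    rw [pow_succ']
    constructor
    · calc _ = _ := by ring
        _ ≤ _ := key.1
    · calc _ ≤ _ := key.2
        _ = _ := by ring

lemma seqD_near_int (κ : ℕ) (g : ℕ → ℝ) (e : ℝ) : ∀ n, (∀ i, n ≤ i → i ≤ n + κ → ∃ z : ℤ, |g i - z| ≤ e) →
    ∃ z : ℤ, |seqD^[κ] g n - z| ≤ 2 ^ κ * e := by
  induction κ with
  | zero => intro n h; simpa using h n le_rfl (by simp)
  | succ κ ih =>
    intro n h
    obtain ⟨z1, h1⟩ := ih n (fun i hi hi' => h i hi (by omega))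
    obtain ⟨z2, h2⟩ := ih (n + 1) (fun i hi hi' => h i (by omega) (by omega))
    refine ⟨z2 - z1, ?_⟩
    rw [Function.iterate_succ_apply']
    simp only [seqD] at *
    rw [abs_le] at *
    push_cast
    rw [pow_succ]
    constructor <;> linarith [h1.1, h1.2, h2.1, h2.2]

lemma poly_recurrence (κ : ℕ) (hκ : 1 ≤ κ) (α η : ℝ) (hη : 0 < η) :
    ∃ q : ℕ, 1 ≤ q ∧ ∃ z : ℤ, |(q : ℝ) ^ κ * α - z| ≤ η := by
  obtain ⟨M, hM⟩ := exists_nat_gt (2 ^ κ / η)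
  have hM0 : (0 : ℝ) < M := lt_of_le_of_lt (by positivity) hM
  have hM0' : 0 < M := by exact_mod_cast hM0
  set g : ℕ → ℝ := fun n => α / κ.factorial * (n : ℝ) ^ κ with hg
  have hlt : ∀ n, ⌊M * Int.fract (g n)⌋₊ < M := fun n => by
    rw [Nat.floor_lt (by have := Int.fract_nonneg (g n); positivity)]
    have := Int.fract_lt_one (g n)
    nlinarith
  obtain ⟨a, ha, b, col, hcol⟩ := Combinatorics.exists_mono_homothetic_copy (Finset.range (κ + 1))
    (fun n : ℕ => (⟨⌊M * Int.fract (g n)⌋₊, hlt n⟩ : Fin M))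
  refine ⟨a, ha, ?_⟩
  set t : ℝ := (col : ℕ) / M with ht
  have hnear : ∀ i, 0 ≤ i → i ≤ 0 + κ → ∃ z : ℤ, |(g (a * i + b) - t) - z| ≤ 1 / M := by
    intro i _ hi
    have h1 := hcol i (Finset.mem_range.2 (by omega))
    have h2 : ⌊M * Int.fract (g (a * i + b))⌋₊ = (col : ℕ) := by
      have := congrArg Fin.val h1
      simpa using this
    refine ⟨⌊g (a * i + b)⌋, ?_⟩
    have e1 : g (a * i + b) - t - ⌊g (a * i + b)⌋ = Int.fract (g (a * i + b)) - t := by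
      rw [Int.fract]; ring
    rw [e1]
    have f0 := Int.fract_nonneg (g (a * i + b))
    have h3 := Nat.floor_le (show 0 ≤ M * Int.fract (g (a * i + b)) by positivity)
    have h4 := Nat.lt_floor_add_one (M * Int.fract (g (a * i + b)))
    rw [h2] at h3 h4
    have e2 : Int.fract (g (a * i + b)) - t = (M * Int.fract (g (a * i + b)) - (col : ℕ)) / M := by
      rw [ht]; field_simp
    rw [e2, abs_of_nonneg (div_nonneg (by linarith) hM0.le)]
    gcongr
    linarith
  obtain ⟨z, hz⟩ := seqD_near_int κ (fun i => g (a * i + b) - t) (1 / M) 0 hnear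
  refine ⟨z, ?_⟩
  have e : seqD^[κ] (fun i => g (a * i + b) - t) 0 = (a : ℝ) ^ κ * α := by
    have := seqD_mvt κ (fun i x => ((Polynomial.derivative^[i] (Polynomial.C (α / κ.factorial) * Polynomial.X ^ κ
        - Polynomial.C t)).eval x)) (-1) (fun i x _ => by
          rw [Function.iterate_succ_apply']
          exact Polynomial.hasDerivAt _ x) a b (by exact_mod_cast ha) 0 (by
            have : (0 : ℝ) ≤ b := Nat.cast_nonneg b
            push_cast; linarith) α α (by
          intro ξ _ _
          have : Polynomial.derivative^[κ] (Polynomial.C (α / κ.factorial) * Polynomial.X ^ κ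
            - Polynomial.C t) = Polynomial.C α := by
            rw [Polynomial.iterate_derivative_sub, Polynomial.iterate_derivative_C_mul,
              Polynomial.iterate_derivative_X_pow_eq_C_mul, Polynomial.iterate_derivative_C (by omega)]
            simp only [Nat.descFactorial_self, Nat.sub_self, pow_zero, mul_one, sub_zero]
            rw [← Polynomial.C_mul]
            congr 1
            field_simp
          simp [this])
    have h5 := le_antisymm this.2 this.1
    rw [mul_comm]
    rw [← h5]
    have e6 : (fun i => g (a * i + b) - t) = (fun m : ℕ => Polynomial.eval ((a : ℝ) * (m : ℝ) + (b : ℝ))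
          ((⇑Polynomial.derivative)^[0] (Polynomial.C (α / ↑κ.factorial) * Polynomial.X ^ κ - Polynomial.C t))) := by
      funext i
      simp [hg]
    rw [e6]
  rw [e] at hz
  refine hz.trans ?_
  rw [div_lt_iff₀ hη] at hM
  rw [mul_one_div, div_le_iff₀ hM0]
  linarith
/-- A derivative family of degree `c`. -/
structure DegFam (c x0 : ℝ) (F : ℕ → ℝ → ℝ) : Prop where
  der : ∀ i x, x0 < x → HasDerivAt (F i) (F (i + 1) x) x
  bd : ∀ ε : ℝ, 0 < ε → ∀ j : ℕ, ∃ A B x1 : ℝ, 0 < A ∧ 0 < B ∧ ∀ x : ℝ, x1 ≤ x →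
    A * x ^ (c - j - ε) ≤ |F j x| ∧ |F j x| ≤ B * x ^ (c - j + ε)

lemma DegFam.smul {c x0 : ℝ} {F : ℕ → ℝ → ℝ} (h : DegFam c x0 F) (r : ℝ) (hr : r ≠ 0) :
    DegFam c x0 (fun j x => r * F j x) := by
  refine ⟨fun i x hx => (h.der i x hx).const_mul r, fun ε hε j => ?_⟩
  obtain ⟨A, B, x1, hA, hB, hx⟩ := h.bd ε hε j
  have hr' : 0 < |r| := abs_pos.2 hr
  refine ⟨|r| * A, |r| * B, x1, by positivity, by positivity, fun x hxx => ?_⟩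
  rw [abs_mul, mul_assoc, mul_assoc]
  exact ⟨mul_le_mul_of_nonneg_left (hx x hxx).1 hr'.le, mul_le_mul_of_nonneg_left (hx x hxx).2 hr'.le⟩

/-- Each derivative has eventually a constant sign. -/
lemma DegFam.sign {c x0 : ℝ} {F : ℕ → ℝ → ℝ} (h : DegFam c x0 F) (j : ℕ) :
    ∃ x2, x0 < x2 ∧ 1 ≤ x2 ∧ ((∀ x, x2 ≤ x → 0 < F j x) ∨ (∀ x, x2 ≤ x → F j x < 0)) := by
  obtain ⟨A, B, x1, hA, hB, hx⟩ := h.bd 1 one_pos j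
  set x2 := max (max x1 (x0 + 1)) 1 with hx2
  have h0 : x0 < x2 := lt_of_lt_of_le (by linarith) ((le_max_right x1 (x0 + 1)).trans (le_max_left _ 1))
  have h1 : x1 ≤ x2 := (le_max_left x1 (x0 + 1)).trans (le_max_left _ 1)
  have h3 : 1 ≤ x2 := le_max_right _ _
  have hne : ∀ x, x2 ≤ x → F j x ≠ 0 := by
    intro x hxx h0
    have := (hx x (h1.trans hxx)).1
    rw [h0, abs_zero] at this
    have hpos : 0 < A * x ^ (c - j - 1) := mul_pos hA (Real.rpow_pos_of_pos (by linarith) _)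
    linarith
  refine ⟨x2, h0, h3, ?_⟩
  have hcont : ContinuousOn (F j) (Set.Ici x2) := fun x hxx =>
    (h.der j x (lt_of_lt_of_le h0 hxx)).continuousAt.continuousWithinAt
  by_contra hcon
  push Not at hcon
  obtain ⟨⟨a, ha, ha'⟩, ⟨b, hb, hb'⟩⟩ := hcon
  obtain ⟨t, ht, ht'⟩ := (isPreconnected_Ici (a := x2)).intermediate_value₂ ha hb hcont
    (continuousOn_const (c := (0:ℝ))) ha' hb'
  exact hne t ht ht'

lemma DegFam.tendsto_zero {c x0 : ℝ} {F : ℕ → ℝ → ℝ} (h : DegFam c x0 F) (j : ℕ) (hj : c < j) :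
    Filter.Tendsto (F j) Filter.atTop (nhds 0) := by
  obtain ⟨A, B, x1, hA, hB, hx⟩ := h.bd ((j - c) / 2) (by linarith) j
  have h1 : Filter.Tendsto (fun x : ℝ => B * x ^ (c - j + (j - c) / 2)) Filter.atTop (nhds 0) := by
    have e : c - j + (j - c) / 2 = - ((j - c) / 2) := by ring
    rw [e]
    simpa using (tendsto_rpow_neg_atTop (y := (j - c) / 2) (by linarith)).const_mul B
  refine squeeze_zero_norm' ?_ h1
  filter_upwards [Filter.eventually_ge_atTop x1] with x hxx
  exact (hx x hxx).2

lemma seq_tendsto_of_der {x0 : ℝ} {F : ℕ → ℝ → ℝ}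
    (hF : ∀ i x, x0 < x → HasDerivAt (F i) (F (i + 1) x) x) (q : ℕ) (hq : 1 ≤ q) (j : ℕ) (L : ℝ)
    (hL : Filter.Tendsto (F j) Filter.atTop (nhds L)) :
    Filter.Tendsto (fun n => seqD^[j] (fun m => F 0 (q * m + 0)) n) Filter.atTop
      (nhds ((q : ℝ) ^ j * L)) := by
  rw [Metric.tendsto_atTop] at *
  intro ε hε
  have hq0 : (0 : ℝ) < q := by exact_mod_cast hq
  have hq1 : (1 : ℝ) ≤ q := by exact_mod_cast hq
  obtain ⟨X, hX⟩ := hL (ε / (2 * (q : ℝ) ^ j)) (by positivity)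
  obtain ⟨N, hN⟩ := exists_nat_gt (max X x0)
  refine ⟨N, fun n hn => ?_⟩
  have hn' : (N : ℝ) ≤ n := by exact_mod_cast hn
  have hqn : (n : ℝ) ≤ q * n + 0 := by nlinarith
  have h1 : X < q * n + 0 := lt_of_le_of_lt (le_max_left _ _) (by linarith)
  have h2 : x0 < q * n + 0 := lt_of_le_of_lt (le_max_right X _) (by linarith)
  have key := seqD_mvt j F x0 hF q 0 hq0 n h2 (L - ε / (2 * (q : ℝ) ^ j)) (L + ε / (2 * (q : ℝ) ^ j))
    (fun ξ h3 _ => by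
      have := hX ξ (by linarith)
      rw [Real.dist_eq, abs_lt] at this
      constructor <;> linarith)
  have e1 : ε / (2 * (q : ℝ) ^ j) * (q : ℝ) ^ j = ε / 2 := by field_simp
  rw [sub_mul, add_mul, e1] at key
  rw [Real.dist_eq, abs_lt]
  constructor <;> linarith [key.1, key.2]

lemma sqrt_step (t : ℝ) (ht : 1 ≤ t) : Real.sqrt (t + 1) - Real.sqrt t ≤ 1 / Real.sqrt t := by
  have h0 : 1 ≤ Real.sqrt t := Real.one_le_sqrt.2 ht
  have h1 := Real.sq_sqrt (show 0 ≤ t by linarith)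
  have h2 := Real.sq_sqrt (show 0 ≤ t + 1 by linarith)
  have h3 : Real.sqrt t ≤ Real.sqrt (t + 1) := Real.sqrt_le_sqrt (by linarith)
  rw [le_div_iff₀ (by linarith)]
  nlinarith

lemma dense_pos {c x0 : ℝ} (hc : 1 ≤ c) {F : ℕ → ℝ → ℝ} (h : DegFam c x0 F)
    (hpos : ∃ x2, x0 < x2 ∧ 1 ≤ x2 ∧ ∀ x, x2 ≤ x → 0 < F (⌊c⌋₊ + 1) x)
    (τ η : ℝ) (hη : 0 < η) (n1 : ℕ) :
    ∃ n ≥ n1, ∃ z : ℤ, |F 0 (n : ℝ) - τ - z| ≤ η := by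
  obtain ⟨x2, hx02, hx21, hp⟩ := hpos
  set κ := ⌊c⌋₊ with hκ
  have hκ1 : 1 ≤ κ := by rw [hκ]; exact Nat.le_floor (by simpa using hc)
  have hκc : (κ : ℝ) ≤ c := Nat.floor_le (by linarith)
  have hcκ : c < ((κ + 1 : ℕ) : ℝ) := by push_cast; exact Nat.lt_floor_add_one c
  have hz := h.tendsto_zero (κ + 1) hcκ
  have hmono : MonotoneOn (F κ) (Set.Ici x2) := by
    apply monotoneOn_of_deriv_nonneg (convex_Ici x2)
    · exact fun x hx => (h.der κ x (lt_of_lt_of_le hx02 hx)).continuousAt.continuousWithinAt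
    · intro x hx
      rw [interior_Ici] at hx
      exact (h.der κ x (lt_trans hx02 hx)).differentiableAt.differentiableWithinAt
    · intro x hx
      rw [interior_Ici] at hx
      rw [(h.der κ x (lt_trans hx02 hx)).deriv]
      exact (hp x (le_of_lt hx)).le
  have hm2 : Monotone (fun x => F κ (max x x2)) := fun a b hab =>
    hmono (Set.mem_Ici.2 (le_max_right _ _)) (Set.mem_Ici.2 (le_max_right _ _)) (max_le_max_right _ hab)
  have hev : (fun x => F κ (max x x2)) =ᶠ[Filter.atTop] F κ := by
    filter_upwards [Filter.eventually_ge_atTop x2] with x hx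
    rw [max_eq_left hx]
  rcases tendsto_atTop_of_monotone hm2 with hT | ⟨L, hL⟩
  · rw [Filter.tendsto_congr' hev] at hT
    have e0 : ∀ n : ℕ, F 0 (n : ℝ) = (fun m : ℕ => F 0 ((1 : ℕ) * m + 0)) n := by intro n; simp
    have h0 := seq_tendsto_of_der h.der 1 le_rfl (κ + 1) 0 hz
    have h1 : Filter.Tendsto (fun n => seqD^[κ] (fun m => F 0 ((1 : ℕ) * m + 0)) n)
        Filter.atTop Filter.atTop := by
      rw [Filter.tendsto_atTop]
      intro K
      obtain ⟨X, hX⟩ := Filter.eventually_atTop.1 (hT.eventually_ge_atTop K)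
      obtain ⟨N, hN⟩ := exists_nat_gt (max X x2)
      filter_upwards [Filter.eventually_ge_atTop N] with n hn
      have hn' : (N : ℝ) ≤ n := by exact_mod_cast hn
      have hn1 : X < n := lt_of_le_of_lt (le_max_left _ _) (by linarith)
      have hn2 : x2 < n := lt_of_le_of_lt (le_max_right X _) (by linarith)
      have key := seqD_mvt κ F x0 h.der (1 : ℕ) 0 (by norm_num) n (by push_cast; linarith) K (F κ (n + κ))
        (fun ξ h3 h4 => by
          push_cast at h3 h4
          refine ⟨hX ξ (by linarith), hmono ?_ ?_ (by linarith)⟩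
          · simp only [Set.mem_Ici]; linarith
          · simp only [Set.mem_Ici]
            have : (0 : ℝ) ≤ κ := Nat.cast_nonneg κ
            linarith)
      simpa using key.1
    simp only [e0]
    refine sweep_dense κ _ 0 (by simpa using h0) ?_ τ η hη n1
    have h2 := Filter.tendsto_abs_atTop_atTop.comp h1
    refine h2.congr (fun n => ?_)
    simp
  · rw [Filter.tendsto_congr' hev] at hL
    obtain ⟨κ', hκ'⟩ : ∃ κ', κ = κ' + 1 := ⟨κ - 1, by omega⟩
    obtain ⟨θ0, hθ0, hch⟩ := sweep_chain κ' τ η hη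
    obtain ⟨q, hq, z, hqz⟩ := poly_recurrence κ hκ1 L θ0 hθ0
    have hq0 : (0 : ℝ) < q := by exact_mod_cast hq
    have hq1 : (1 : ℝ) ≤ q := by exact_mod_cast hq
    have h0 := seq_tendsto_of_der h.der q hq κ L hL
    set x : ℕ → ℝ := fun m => F 0 (q * m + 0) with hx
    suffices hs : ∃ n ≥ n1, ∃ z : ℤ, |x n - τ - z| ≤ η by
      obtain ⟨n, hn, z, hz⟩ := hs
      refine ⟨q * n, by nlinarith, z, ?_⟩
      simpa [hx] using hz
    by_cases hθ : (q : ℝ) ^ κ * L - z = 0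
    · have hzL : (q : ℝ) ^ κ * L = z := by linarith
      rw [hzL] at h0
      rw [hκ'] at h0
      refine sweep_dense κ' x z h0 ?_ τ η hη n1
      -- lower bound for the approach to the limit
      obtain ⟨A, B, x1, hA, hB, hbd⟩ := h.bd (1 / 2) (by norm_num) (κ + 1)
      set x3 := max x1 x2 with hx3
      have hgap : ∀ t, x3 ≤ t → F κ t ≤ L - A / (4 * Real.sqrt t) := by
        intro t ht
        have ht1 : x1 ≤ t := (le_max_left _ _).trans ht
        have ht2 : x2 ≤ t := (le_max_right _ _).trans ht
        have hLup : F κ (2 * t) ≤ L := by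
          refine ge_of_tendsto hL ?_
          filter_upwards [Filter.eventually_ge_atTop (2 * t)] with s hs
          exact hmono (show x2 ≤ 2 * t by linarith) (show x2 ≤ s by linarith) hs
        obtain ⟨ξ, hξ, hξ'⟩ := exists_hasDerivAt_eq_slope (F κ) (F (κ + 1)) (show t < 2 * t by linarith)
          (fun s hs => (h.der κ s (by linarith [hs.1])).continuousAt.continuousWithinAt)
          (fun s hs => h.der κ s (by linarith [hs.1]))
        have hb1 := (hbd ξ (by linarith [hξ.1])).1
        rw [abs_of_pos (hp ξ (by linarith [hξ.1]))] at hb1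
        have hξ1 : 1 ≤ ξ := by linarith [hξ.1]
        have hb2 : 1 / (ξ * Real.sqrt ξ) ≤ ξ ^ (c - ((κ + 1 : ℕ) : ℝ) - 1 / 2) := by
          have e1 : 1 / (ξ * Real.sqrt ξ) = ξ ^ (-(3 / 2) : ℝ) := by
            rw [Real.sqrt_eq_rpow, Real.rpow_neg (by linarith), one_div]
            congr 1
            rw [show (3 / 2 : ℝ) = 1 + 1 / 2 by norm_num, Real.rpow_add (by linarith), Real.rpow_one]
          rw [e1]
          apply Real.rpow_le_rpow_of_exponent_le hξ1
          push_cast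
          linarith
        have hst : 1 ≤ Real.sqrt t := Real.one_le_sqrt.2 (by linarith)
        have hs1 : Real.sqrt ξ ≤ 2 * Real.sqrt t := by
          rw [show (2 : ℝ) * Real.sqrt t = Real.sqrt (4 * t) by
            rw [Real.sqrt_mul (by norm_num), show (4 : ℝ) = 2 ^ 2 by norm_num, Real.sqrt_sq (by norm_num)]]
          exact Real.sqrt_le_sqrt (by linarith [hξ.2])
        have hb3 : 1 / (2 * t * (2 * Real.sqrt t)) ≤ 1 / (ξ * Real.sqrt ξ) := by
          have : 0 < Real.sqrt ξ := Real.sqrt_pos.2 (by linarith)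
          apply one_div_le_one_div_of_le (by positivity)
          apply mul_le_mul hξ.2.le hs1 this.le (by linarith)
        have hb4 : A * (1 / (2 * t * (2 * Real.sqrt t))) ≤ F (κ + 1) ξ :=
          (mul_le_mul_of_nonneg_left (hb3.trans hb2) hA.le).trans hb1
        rw [hξ', show 2 * t - t = t by ring, le_div_iff₀ (by linarith)] at hb4
        have e2 : A * (1 / (2 * t * (2 * Real.sqrt t))) * t = A / (4 * Real.sqrt t) := by
          have : t ≠ 0 := by linarith
          field_simp
          norm_num
        rw [e2] at hb4
        linarith
      set u : ℕ → ℝ := fun n => seqD^[κ'] x n - z * n with hu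
      obtain ⟨N, hN⟩ := exists_nat_gt (max x3 x0)
      have hN3 : x3 < N := lt_of_le_of_lt (le_max_left _ _) hN
      have hN0 : x0 < N := lt_of_le_of_lt (le_max_right x3 _) hN
      have hN1 : (1 : ℝ) ≤ N := by linarith [le_max_right x1 x2]
      set A' := A / (4 * q) with hA'
      have hA'0 : 0 < A' := by positivity
      have hstep : ∀ n, N ≤ n → u (n + 1) + A' * Real.sqrt ((n + 1 : ℕ) + κ) ≤ u n + A' * Real.sqrt (n + κ) := by
        intro n hn
        have hn' : (N : ℝ) ≤ n := by exact_mod_cast hn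
        have hqn : (n : ℝ) ≤ q * n + 0 := by nlinarith
        have hκ0 : (0 : ℝ) ≤ κ := Nat.cast_nonneg κ
        have hsq : 0 < Real.sqrt (n + κ) := Real.sqrt_pos.2 (by linarith)
        have key := (seqD_mvt κ F x0 h.der q 0 hq0 n (by linarith) (F κ x2)
          (L - A' / Real.sqrt (n + κ))
          (fun ξ h3 h4 => by
            have hξ3 : x3 ≤ ξ := by linarith
            refine ⟨hmono (show x2 ≤ x2 from le_rfl) (show x2 ≤ ξ by linarith [le_max_right x1 x2])
              (by linarith [le_max_right x1 x2]), (hgap ξ hξ3).trans ?_⟩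
            have hs1 : Real.sqrt ξ ≤ q * Real.sqrt (n + κ) := by
              rw [show (q : ℝ) * Real.sqrt (n + κ) = Real.sqrt (q ^ 2 * (n + κ)) by
                rw [Real.sqrt_mul (by positivity), Real.sqrt_sq hq0.le]]
              apply Real.sqrt_le_sqrt
              nlinarith
            have hξ0 : 0 < Real.sqrt ξ := Real.sqrt_pos.2 (by linarith)
            have : A' / Real.sqrt (n + κ) ≤ A / (4 * Real.sqrt ξ) := by
              rw [hA', div_div]
              apply div_le_div_of_nonneg_left hA.le (by positivity)
              nlinarith
            linarith)).2
        have hD : u (n + 1) - u n = seqD^[κ] x n - z := by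
          simp only [hu]
          rw [hκ', Function.iterate_succ_apply']
          simp only [seqD]
          push_cast
          ring
        have hqk : (1 : ℝ) ≤ (q : ℝ) ^ κ := one_le_pow₀ hq1
        have h5 : A' / Real.sqrt (n + κ) ≤ A' / Real.sqrt (n + κ) * (q : ℝ) ^ κ :=
          le_mul_of_one_le_right (by positivity) hqk
        have h6 := sqrt_step (n + κ) (by linarith)
        have h7 : A' * (Real.sqrt (n + κ + 1) - Real.sqrt (n + κ)) ≤ A' / Real.sqrt (n + κ) := by
          calc _ ≤ A' * (1 / Real.sqrt (n + κ)) := mul_le_mul_of_nonneg_left h6 hA'0.le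
            _ = _ := by ring
        rw [sub_mul] at key
        rw [show (((n + 1 : ℕ) : ℝ) + κ) = n + κ + 1 by push_cast; ring]
        linarith
      have hall : ∀ n, N ≤ n → u n + A' * Real.sqrt (n + κ) ≤ u N + A' * Real.sqrt (N + κ) := by
        intro n hn
        induction n, hn using Nat.le_induction with
        | base => exact le_rfl
        | succ n hn ih => exact (hstep n hn).trans ih
      have hlim : Filter.Tendsto u Filter.atTop Filter.atBot := by
        have hsqrt : Filter.Tendsto (fun n : ℕ => u N + A' * Real.sqrt (N + κ) - A' * Real.sqrt (n + κ))
            Filter.atTop Filter.atBot := by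
          apply Filter.tendsto_atBot_add_const_left _ _ _ |>.congr (fun n => (sub_eq_add_neg _ _).symm)
          apply Filter.tendsto_neg_atTop_atBot.comp
          apply Filter.Tendsto.const_mul_atTop hA'0
          apply Real.tendsto_sqrt_atTop.comp
          exact Filter.tendsto_atTop_add_const_right _ _ tendsto_natCast_atTop_atTop
        refine Filter.tendsto_atBot_mono' _ ?_ hsqrt
        filter_upwards [Filter.eventually_ge_atTop N] with n hn
        linarith [hall n hn]
      exact Filter.tendsto_abs_atBot_atTop.comp hlim
    · obtain ⟨W, hW⟩ := hch ((q : ℝ) ^ κ * L - z) hθ hqz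
      obtain ⟨N, hN⟩ := (Metric.tendsto_atTop.1 h0) (|(q : ℝ) ^ κ * L - z| / 2)
        (by have := abs_pos.2 hθ; positivity)
      obtain ⟨n', hn', hfin⟩ := hW x (max N n1) (fun s _ => by
        refine ⟨z, ?_⟩
        have := hN (max N n1 + s) (by have := le_max_left N n1; omega)
        rw [Real.dist_eq, hκ'] at this
        rw [← hκ'] at this ⊢
        have e : seqD^[κ] x (max N n1 + s) - ((q : ℝ) ^ κ * L - z) - z =
          seqD^[κ] x (max N n1 + s) - (q : ℝ) ^ κ * L := by ring
        rw [e]; exact this.le)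
      exact ⟨n', le_trans (le_max_right _ _) hn', hfin⟩

lemma dense_mod {c x0 : ℝ} (hc : 1 ≤ c) {F : ℕ → ℝ → ℝ} (h : DegFam c x0 F)
    (τ η : ℝ) (hη : 0 < η) (n1 : ℕ) :
    ∃ n ≥ n1, ∃ z : ℤ, |F 0 (n : ℝ) - τ - z| ≤ η := by
  obtain ⟨x2, h1, h2, h3 | h3⟩ := h.sign (⌊c⌋₊ + 1)
  · exact dense_pos hc h ⟨x2, h1, h2, h3⟩ τ η hη n1
  · obtain ⟨n, hn, z, hz⟩ := dense_pos hc (h.smul (-1) (by norm_num))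
      ⟨x2, h1, h2, fun x hx => by linarith [h3 x hx]⟩ (-τ) η hη n1
    refine ⟨n, hn, -z, ?_⟩
    rw [← abs_neg]
    convert hz using 2
    push_cast; ring

/-- The floors are not all congruent to each other modulo `d ≥ 2`. -/
lemma floor_not_const_mod {c x0 : ℝ} (hc : 1 ≤ c) {F : ℕ → ℝ → ℝ} (h : DegFam c x0 F)
    (d : ℤ) (hd : 2 ≤ d) (n1 : ℕ) (r : ℤ) :
    ∃ n : ℕ, n1 ≤ n ∧ ¬ d ∣ ⌊F 0 (n : ℝ)⌋ - r := by
  have hd0 : (0 : ℝ) < d := by exact_mod_cast (by omega : 0 < d)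
  obtain ⟨n, hn, z, hz⟩ := dense_mod hc (h.smul (1 / d) (by positivity)) ((r + 3 / 2) / d) (1 / (4 * d))
    (by positivity) n1
  refine ⟨n, hn, ?_⟩
  have h1 : |F 0 (n : ℝ) - (r + 3 / 2) - d * z| ≤ 1 / 4 := by
    have e : F 0 (n : ℝ) - (r + 3 / 2) - d * z = d * (1 / d * F 0 (n : ℝ) - (r + 3 / 2) / d - z) := by
      field_simp
    rw [e, abs_mul, abs_of_pos hd0]
    calc _ ≤ (d : ℝ) * (1 / (4 * (d : ℝ))) := mul_le_mul_of_nonneg_left hz hd0.le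
      _ = 1 / 4 := by field_simp
  rw [abs_le] at h1
  have h2 : ⌊F 0 (n : ℝ)⌋ = r + 1 + d * z := by
    rw [Int.floor_eq_iff]
    push_cast
    constructor <;> linarith [h1.1, h1.2]
  rw [h2]
  rintro ⟨w, hw⟩
  have : d * (w - z) = 1 := by linarith
  have h3 := Int.eq_one_or_neg_one_of_mul_eq_one this
  omega

/-- Normalised even Gaussian moments. -/
def gm (j : ℕ) : ℚ := ((2 * j).factorial : ℚ) / ((j.factorial : ℚ) * 4 ^ j)

lemma gm_pos (j : ℕ) : 0 < gm j := by
  unfold gm; positivity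

lemma gm_succ (j : ℕ) : gm (j + 1) = (j + 1 / 2) * gm j := by
  unfold gm
  rw [show 2 * (j + 1) = (2 * j + 1) + 1 by ring, Nat.factorial_succ, Nat.factorial_succ,
    Nat.factorial_succ]
  push_cast
  field_simp
  ring

lemma gm_gamma (j : ℕ) : Real.Gamma ((j : ℝ) + 1 / 2) = Real.sqrt Real.pi * gm j := by
  induction j with
  | zero => 
    have : gm 0 = 1 := by simp [gm]
    rw [this]
    simpa using Real.Gamma_one_half_eq
  | succ j ih =>
    have e : ((j + 1 : ℕ) : ℝ) + 1 / 2 = ((j : ℝ) + 1 / 2) + 1 := by push_cast; ring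
    rw [e, Real.Gamma_add_one (by positivity), ih, gm_succ]
    push_cast; ring

lemma gm_poly_pos (P : Polynomial ℝ) (h : ∀ t : ℝ, 0 < t → 0 ≤ P.eval t)
    (hs : ∑ j ∈ range (P.natDegree + 1), P.coeff j * (gm j : ℝ) ≤ 0) : P = 0 := by
  by_contra hP
  set w : ℝ → ℝ := fun t => Real.exp (-t) * t ^ ((1 / 2 : ℝ) - 1) with hw
  have hI : ∀ j : ℕ, MeasureTheory.IntegrableOn (fun t : ℝ => t ^ j * w t) (Set.Ioi 0) := by
    intro j
    have := Real.GammaIntegral_convergent (s := (j : ℝ) + 1 / 2) (by positivity)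
    refine this.congr_fun (fun t ht => ?_) measurableSet_Ioi
    have ht : (0 : ℝ) < t := ht
    simp only [hw]
    rw [show (j : ℝ) + 1 / 2 - 1 = (j : ℝ) + ((1 / 2 : ℝ) - 1) by ring, Real.rpow_add ht,
      Real.rpow_natCast]
    ring
  have hV : ∀ j : ℕ, ∫ t in Set.Ioi (0 : ℝ), t ^ j * w t = Real.sqrt Real.pi * gm j := by
    intro j
    rw [← gm_gamma, Real.Gamma_eq_integral (by positivity)]
    refine MeasureTheory.setIntegral_congr_fun measurableSet_Ioi (fun t ht => ?_)
    have ht : (0 : ℝ) < t := ht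
    simp only [hw]
    rw [show (j : ℝ) + 1 / 2 - 1 = (j : ℝ) + ((1 / 2 : ℝ) - 1) by ring, Real.rpow_add ht,
      Real.rpow_natCast]
    ring
  have hexp : ∀ t : ℝ, P.eval t * w t =
      ∑ j ∈ range (P.natDegree + 1), P.coeff j * (t ^ j * w t) := by
    intro t
    rw [Polynomial.eval_eq_sum_range, Finset.sum_mul]
    exact Finset.sum_congr rfl (fun j _ => by ring)
  have hintg : MeasureTheory.IntegrableOn (fun t : ℝ => P.eval t * w t) (Set.Ioi 0) := by
    simp only [hexp]
    exact MeasureTheory.integrable_finsetSum _ (fun j _ => (hI j).const_mul _)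
  have hval : ∫ t in Set.Ioi (0 : ℝ), P.eval t * w t =
      Real.sqrt Real.pi * ∑ j ∈ range (P.natDegree + 1), P.coeff j * (gm j : ℝ) := by
    simp only [hexp]
    rw [MeasureTheory.integral_finsetSum _ (fun j _ => (hI j).const_mul _), Finset.mul_sum]
    refine Finset.sum_congr rfl (fun j _ => ?_)
    rw [MeasureTheory.integral_const_mul, hV]; ring
  have hpos : 0 < ∫ t in Set.Ioi (0 : ℝ), P.eval t * w t := by
    rw [MeasureTheory.setIntegral_pos_iff_support_of_nonneg_ae _ hintg]
    · have hsub : Set.Ioi (0 : ℝ) \ {x | P.eval x = 0} ⊆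
          Function.support (fun t => P.eval t * w t) ∩ Set.Ioi 0 := by
        rintro t ⟨ht, h2⟩
        refine ⟨?_, ht⟩
        have ht : (0 : ℝ) < t := ht
        have : 0 < w t := by simp only [hw]; positivity
        exact mul_ne_zero h2 this.ne'
      have hfin : ({x | P.eval x = 0} : Set ℝ).Finite := by
        have := P.rootSet_finite ℝ
        refine this.subset (fun x hx => ?_)
        rw [Polynomial.mem_rootSet]
        exact ⟨hP, by simpa using hx⟩
      refine lt_of_lt_of_le ?_ (MeasureTheory.measure_mono hsub)
      rw [MeasureTheory.measure_sdiff_null (hfin.measure_zero _)]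
      simp
    · filter_upwards [MeasureTheory.ae_restrict_mem measurableSet_Ioi] with t ht
      have ht : (0 : ℝ) < t := ht
      have : 0 < w t := by simp only [hw]; positivity
      exact mul_nonneg (h t ht) this.le
  rw [hval] at hpos
  have := Real.sqrt_pos.2 Real.pi_pos
  nlinarith

lemma vand_solve (𝕜 : Type*) [Field 𝕜] [LinearOrder 𝕜] [IsStrictOrderedRing 𝕜] (K : ℕ) :
    ∃ L : 𝕜, 0 < L ∧ ∀ (δ : 𝕜) (e : Fin (K + 1) → 𝕜), (∀ j, |e j| ≤ δ) →
      ∃ a : Fin (K + 1) → 𝕜, (∀ i, |a i| ≤ δ * L) ∧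
        ∀ j, e j = ∑ i, a i * ((i : ℕ) : 𝕜) ^ (2 * (j : ℕ)) := by
  set W : Matrix (Fin (K + 1)) (Fin (K + 1)) 𝕜 :=
    Matrix.vandermonde (fun i => (((i : ℕ) : 𝕜)) ^ 2) with hW
  have hdet : IsUnit W.det := by
    rw [isUnit_iff_ne_zero, hW, Matrix.det_vandermonde_ne_zero_iff]
    intro i j hij
    have h2 : (((i : ℕ) : 𝕜)) = ((j : ℕ) : 𝕜) := by
      simpa [abs_of_nonneg] using (sq_eq_sq₀ (Nat.cast_nonneg _) (Nat.cast_nonneg _)).1 hij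
    exact Fin.ext (by exact_mod_cast h2)
  refine ⟨∑ j, ∑ i, |W⁻¹ j i| + 1, by positivity, fun δ e he => ⟨Matrix.vecMul e W⁻¹, fun i => ?_, ?_⟩⟩
  · have hδ : 0 ≤ δ := (abs_nonneg _).trans (he 0)
    calc |Matrix.vecMul e W⁻¹ i| = |∑ j, e j * W⁻¹ j i| := rfl
      _ ≤ ∑ j, |e j * W⁻¹ j i| := Finset.abs_sum_le_sum_abs _ _
      _ ≤ ∑ j, δ * ∑ i, |W⁻¹ j i| := by
        refine Finset.sum_le_sum (fun j _ => ?_)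
        rw [abs_mul]
        refine mul_le_mul (he j) ?_ (abs_nonneg _) hδ
        exact Finset.single_le_sum (f := fun i => |W⁻¹ j i|) (fun i _ => abs_nonneg _) (Finset.mem_univ i)
      _ = δ * ∑ j, ∑ i, |W⁻¹ j i| := by rw [Finset.mul_sum]
      _ ≤ _ := mul_le_mul_of_nonneg_left (by linarith) hδ
  · intro j
    have h1 : Matrix.vecMul (Matrix.vecMul e W⁻¹) W = e := by
      rw [Matrix.vecMul_vecMul, Matrix.nonsing_inv_mul _ hdet, Matrix.vecMul_one]
    conv_lhs => rw [← h1]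
    simp only [Matrix.vecMul, dotProduct, hW, Matrix.vandermonde_apply]
    refine Finset.sum_congr rfl (fun i _ => ?_)
    rw [pow_mul]

/-- Rational vectors which are moment vectors of finite positive rational combinations. -/
def CQ (K : ℕ) : Set (Fin (K + 1) → ℚ) :=
  {x | ∃ N : ℕ, 0 < N ∧ ∃ S : Multiset ℚ, ∀ j : Fin (K + 1),
    (N : ℚ) * x j = (S.map (fun q => q ^ (2 * (j : ℕ)))).sum}

lemma CQ_add {K : ℕ} {x y : Fin (K + 1) → ℚ} (hx : x ∈ CQ K) (hy : y ∈ CQ K) : x + y ∈ CQ K := by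
  obtain ⟨N, hN, S, hS⟩ := hx
  obtain ⟨M, hM, T, hT⟩ := hy
  refine ⟨N * M, by positivity, M • S + N • T, fun j => ?_⟩
  rw [Multiset.map_add, Multiset.sum_add, Multiset.map_nsmul, Multiset.map_nsmul,
    Multiset.sum_nsmul, Multiset.sum_nsmul, ← hS, ← hT]
  simp only [Pi.add_apply, nsmul_eq_mul]
  push_cast; ring

lemma CQ_smul {K : ℕ} {x : Fin (K + 1) → ℚ} (hx : x ∈ CQ K) (r : ℚ) (hr : 0 ≤ r) :
    r • x ∈ CQ K := by
  obtain ⟨N, hN, S, hS⟩ := hx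
  refine ⟨N * r.den, by have := r.den_pos; positivity, r.num.toNat • S, fun j => ?_⟩
  rw [Multiset.map_nsmul, Multiset.sum_nsmul, ← hS]
  have h1 : ((r.num.toNat : ℕ) : ℚ) = r.num := by
    have : ((r.num.toNat : ℕ) : ℤ) = r.num := Int.toNat_of_nonneg (Rat.num_nonneg.2 hr)
    exact_mod_cast this
  have h2 : (r.den : ℚ) * r = r.num := Rat.den_mul_eq_num r
  simp only [Pi.smul_apply, nsmul_eq_mul, smul_eq_mul]
  rw [h1, ← h2]; push_cast; ring

lemma CQ_vec {K : ℕ} (q : ℚ) : (fun j : Fin (K + 1) => q ^ (2 * (j : ℕ))) ∈ CQ K :=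
  ⟨1, one_pos, {q}, fun j => by simp⟩

lemma CQ_zero {K : ℕ} : (0 : Fin (K + 1) → ℚ) ∈ CQ K := ⟨1, one_pos, 0, fun j => by simp⟩

lemma CQ_sum {K : ℕ} {ι : Type*} (s : Finset ι) (x : ι → Fin (K + 1) → ℚ)
    (hx : ∀ i ∈ s, x i ∈ CQ K) : ∑ i ∈ s, x i ∈ CQ K := by
  classical
  induction s using Finset.induction_on with
  | empty => simpa using CQ_zero
  | insert a s ha ih =>
    rw [Finset.sum_insert ha]
    exact CQ_add (hx a (by simp)) (ih (fun i hi => hx i (by simp [hi])))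

/-- coordinatewise cast -/
def rc {K : ℕ} (x : Fin (K + 1) → ℚ) : Fin (K + 1) → ℝ := fun j => (x j : ℝ)

lemma rc_zero {K : ℕ} : rc (0 : Fin (K + 1) → ℚ) = 0 := by
  ext j; simp [rc]

/-- closed real cone -/
def CR (K : ℕ) : Set (Fin (K + 1) → ℝ) := closure (Set.image rc (CQ K))

lemma CR_add {K : ℕ} {x y : Fin (K + 1) → ℝ} (hx : x ∈ CR K) (hy : y ∈ CR K) : x + y ∈ CR K := by
  refine map_mem_closure₂ continuous_add hx hy ?_
  rintro _ ⟨a, ha, rfl⟩ _ ⟨b, hb, rfl⟩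
  exact ⟨a + b, CQ_add ha hb, by ext j; simp [rc]⟩

lemma CR_smul {K : ℕ} {x : Fin (K + 1) → ℝ} (hx : x ∈ CR K) (r : ℝ) (hr : 0 ≤ r) :
    r • x ∈ CR K := by
  have hr' : r ∈ closure (Set.image (fun q : ℚ => (q : ℝ)) {q | 0 ≤ q}) := by
    rw [Metric.mem_closure_iff]
    intro ε hε
    obtain ⟨q, h1, h2⟩ := exists_rat_btwn (show r < r + ε by linarith)
    refine ⟨q, ⟨q, ?_, rfl⟩, ?_⟩
    · have : (0 : ℝ) ≤ q := by linarith
      exact_mod_cast this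
    · rw [Real.dist_eq, abs_lt]; constructor <;> linarith
  refine map_mem_closure₂ continuous_smul hr' hx ?_
  rintro _ ⟨a, ha, rfl⟩ _ ⟨b, hb, rfl⟩
  exact ⟨a • b, CQ_smul hb a ha, by ext j; simp [rc]⟩

lemma CR_of {K : ℕ} {x : Fin (K + 1) → ℚ} (hx : x ∈ CQ K) : rc x ∈ CR K :=
  subset_closure ⟨x, hx, rfl⟩

lemma CR_convex (K : ℕ) : Convex ℝ (CR K) := by
  intro x hx y hy a b ha hb _
  exact CR_add (CR_smul hx a ha) (CR_smul hy b hb)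

lemma CR_sum {K : ℕ} {ι : Type*} (s : Finset ι) (x : ι → Fin (K + 1) → ℝ)
    (hx : ∀ i ∈ s, x i ∈ CR K) : ∑ i ∈ s, x i ∈ CR K := by
  classical
  induction s using Finset.induction_on with
  | empty => simpa [rc_zero] using CR_of (CQ_zero (K := K))
  | insert a s ha ih =>
    rw [Finset.sum_insert ha]
    exact CR_add (hx a (by simp)) (ih (fun i hi => hx i (by simp [hi])))

lemma CR_interior (K : ℕ) : (interior (CR K)).Nonempty := by
  obtain ⟨L, hL, hsol⟩ := vand_solve ℝ K
  set w : Fin (K + 1) → ℝ := fun j => ∑ i : Fin (K + 1), ((i : ℕ) : ℝ) ^ (2 * (j : ℕ)) with hw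
  refine ⟨w, ?_⟩
  rw [mem_interior_iff_mem_nhds, Metric.mem_nhds_iff]
  refine ⟨1 / L, by positivity, fun y hy => ?_⟩
  have hy' : ∀ j, |(y - w) j| ≤ 1 / L := by
    intro j
    have h1 := norm_le_pi_norm (y - w) j
    rw [Metric.mem_ball, dist_eq_norm] at hy
    exact (Real.norm_eq_abs _ ▸ h1).trans hy.le
  obtain ⟨a, ha, hsum⟩ := hsol (1 / L) (y - w) hy'
  have e : y = ∑ i : Fin (K + 1), (1 + a i) • rc (fun j : Fin (K + 1) => ((i : ℕ) : ℚ) ^ (2 * (j : ℕ))) := by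
    ext j
    have h1 := hsum j
    simp only [Pi.sub_apply, hw] at h1
    simp only [Finset.sum_apply, Pi.smul_apply, smul_eq_mul, rc]
    push_cast
    simp only [add_mul, one_mul, Finset.sum_add_distrib]
    linarith
  rw [e]
  refine CR_sum _ _ (fun i _ => CR_smul (CR_of (CQ_vec _)) _ ?_)
  have := ha i
  rw [one_div, inv_mul_cancel₀ hL.ne', abs_le] at this
  linarith

lemma gm_mem_interior (K : ℕ) : rc (fun j : Fin (K + 1) => gm (j : ℕ)) ∈ interior (CR K) := by
  set γ : Fin (K + 1) → ℝ := rc (fun j : Fin (K + 1) => gm (j : ℕ)) with hγ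
  by_contra hn
  obtain ⟨ℓ, hℓ⟩ := geometric_hahn_banach_open_point (CR_convex K).interior isOpen_interior hn
  obtain ⟨e0, he0⟩ := CR_interior K
  have hneg : ∀ a ∈ CR K, ℓ a ≤ 0 := by
    intro a ha
    by_contra hpos
    push Not at hpos
    have key : ∀ n : ℕ, n * ℓ a + ℓ e0 < ℓ γ := by
      intro n
      have hmem : (n : ℝ) • a + e0 ∈ interior (CR K) := by
        have h1 : Set.image (fun x => (n : ℝ) • a + x) (interior (CR K)) ⊆ interior (CR K) := by
          refine interior_maximal ?_ ?_
          · rintro _ ⟨x, hx, rfl⟩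
            exact CR_add (CR_smul ha _ (Nat.cast_nonneg n)) (interior_subset hx)
          · exact (Homeomorph.addLeft ((n : ℝ) • a)).isOpenMap _ isOpen_interior
        exact h1 ⟨e0, he0, rfl⟩
      have := hℓ _ hmem
      simpa using this
    obtain ⟨n, hn⟩ := exists_nat_gt ((ℓ γ - ℓ e0) / ℓ a)
    rw [div_lt_iff₀ hpos] at hn
    linarith [key n]
  have hγ0 : 0 ≤ ℓ γ := by
    by_contra hlt
    push Not at hlt
    have he0n := hneg e0 (interior_subset he0)
    obtain ⟨t, ht0, ht1, ht2⟩ : ∃ t : ℝ, 0 < t ∧ t ≤ 1 ∧ ℓ γ ≤ t * ℓ e0 := by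
      refine ⟨min 1 (ℓ γ / (ℓ e0 - 1)), ?_, min_le_left _ _, ?_⟩
      · exact lt_min one_pos (div_pos_of_neg_of_neg hlt (by linarith))
      · have h1 : min 1 (ℓ γ / (ℓ e0 - 1)) ≤ ℓ γ / (ℓ e0 - 1) := min_le_right _ _
        have h2 : ℓ γ / (ℓ e0 - 1) * (ℓ e0 - 1) = ℓ γ := div_mul_cancel₀ _ (by linarith)
        have h3 : 0 < ℓ γ / (ℓ e0 - 1) := div_pos_of_neg_of_neg hlt (by linarith)
        have h4 := mul_le_mul_of_nonpos_right h1 he0n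
        nlinarith
    have h0 : (0 : Fin (K + 1) → ℝ) ∈ CR K := by
      have := CR_of (CQ_zero (K := K)); simpa [rc_zero] using this
    have hm := (CR_convex K).combo_interior_self_mem_interior he0 h0 ht0 (b := 1 - t) (by linarith) (by ring)
    have := hℓ _ hm
    simp at this
    linarith
  set P : Polynomial ℝ := ∑ j : Fin (K + 1), Polynomial.monomial (j : ℕ) (-(ℓ (Pi.single j 1))) with hP
  have hℓe : ∀ x : Fin (K + 1) → ℝ, ℓ x = ∑ j, x j * ℓ (Pi.single j 1) := by
    intro x
    conv_lhs => rw [pi_eq_sum_univ' x]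
    rw [map_sum]
    refine Finset.sum_congr rfl (fun j _ => ?_)
    rw [map_smul, smul_eq_mul]
  have hev : ∀ t : ℝ, P.eval t = - ∑ j : Fin (K + 1), t ^ (j : ℕ) * ℓ (Pi.single j 1) := by
    intro t
    rw [hP, Polynomial.eval_finsetSum, ← Finset.sum_neg_distrib]
    refine Finset.sum_congr rfl (fun j _ => ?_)
    rw [Polynomial.eval_monomial]; ring
  have hcoef : ∀ j : Fin (K + 1), P.coeff j = -(ℓ (Pi.single j 1)) := by
    intro j
    rw [hP, Polynomial.finsetSum_coeff, Finset.sum_eq_single j]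
    · simp
    · intro b _ hb
      rw [Polynomial.coeff_monomial, if_neg]
      exact fun h => hb (Fin.ext h)
    · simp
  have hdeg : P.natDegree ≤ K := by
    rw [hP]
    refine Polynomial.natDegree_sum_le_of_forall_le _ _ (fun j _ => ?_)
    exact (Polynomial.natDegree_monomial_le _).trans (by omega)
  have hsum : ∑ j ∈ range (P.natDegree + 1), P.coeff j * (gm j : ℝ) = - ℓ γ := by
    have h1 : ∑ j ∈ range (P.natDegree + 1), P.coeff j * (gm j : ℝ) =
        ∑ j ∈ range (K + 1), P.coeff j * (gm j : ℝ) := by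
      refine Finset.sum_subset (by simpa using hdeg) (fun j _ hj => ?_)
      rw [Polynomial.coeff_eq_zero_of_natDegree_lt (by simpa using hj), zero_mul]
    rw [h1, Finset.sum_range, hℓe, ← Finset.sum_neg_distrib]
    refine Finset.sum_congr rfl (fun j _ => ?_)
    rw [hcoef]; simp only [hγ, rc]; ring
  have hP0 : P = 0 := by
    refine gm_poly_pos P (fun t ht => ?_) (by rw [hsum]; linarith)
    have hc : Continuous (fun x : ℝ => P.eval (x ^ 2)) := by fun_prop
    have hq : ∀ x : ℝ, 0 ≤ P.eval (x ^ 2) := by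
      intro x
      refine Rat.denseRange_cast.induction_on (p := fun x : ℝ => 0 ≤ P.eval (x ^ 2)) x
        (isClosed_le continuous_const hc) (fun q => ?_)
      have := hneg _ (CR_of (CQ_vec (K := K) q))
      rw [hℓe] at this
      rw [hev]
      simp only [rc] at this
      push_cast at this
      simp only [← pow_mul]
      linarith
    have := hq (Real.sqrt t)
    rwa [Real.sq_sqrt ht.le] at this
  have hℓ0 : ∀ x, ℓ x = 0 := by
    intro x
    rw [hℓe]
    refine Finset.sum_eq_zero (fun j _ => ?_)
    have := hcoef j
    rw [hP0] at this
    simp at this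
    rw [this, mul_zero]
  have := hℓ e0 he0
  rw [hℓ0, hℓ0] at this
  exact lt_irrefl _ this

lemma gm_mem_CQ (K : ℕ) : (fun j : Fin (K + 1) => gm (j : ℕ)) ∈ CQ K := by
  set w : Fin (K + 1) → ℚ := fun j => ∑ i : Fin (K + 1), ((i : ℕ) : ℚ) ^ (2 * (j : ℕ)) with hw
  have hmem := gm_mem_interior K
  set γ : Fin (K + 1) → ℚ := fun j : Fin (K + 1) => gm (j : ℕ) with hγ
  obtain ⟨η, hη, hηm⟩ : ∃ η : ℚ, 0 < η ∧ rc (γ - η • w) ∈ CR K := by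
    have hc : Filter.Tendsto (fun t : ℝ => rc γ - t • rc w) (nhds 0) (nhds (rc γ)) := by
      have : Continuous (fun t : ℝ => rc γ - t • rc w) := by fun_prop
      simpa using this.tendsto 0
    have h1 := hc (mem_interior_iff_mem_nhds.1 hmem)
    rw [Filter.mem_map, Metric.mem_nhds_iff] at h1
    obtain ⟨ε, hε, h2⟩ := h1
    obtain ⟨q, hq1, hq2⟩ := exists_rat_btwn hε
    refine ⟨q, by exact_mod_cast hq1, ?_⟩
    have h3 : (q : ℝ) ∈ Metric.ball (0 : ℝ) ε := by
      rw [Metric.mem_ball, Real.dist_eq, sub_zero, abs_of_pos hq1]; exact hq2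
    have h4 := h2 h3
    have e : rc (γ - q • w) = rc γ - (q : ℝ) • rc w := by ext j; simp [rc]
    rw [e]; exact h4
  obtain ⟨L, hL, hsol⟩ := vand_solve ℚ K
  have hδ : (0 : ℝ) < ((η / L : ℚ) : ℝ) := by
    have : 0 < η / L := by positivity
    exact_mod_cast this
  obtain ⟨_, ⟨κ, hκ, rfl⟩, hd⟩ := Metric.mem_closure_iff.1 hηm _ hδ
  have hy' : ∀ j, |(γ - η • w - κ) j| ≤ η / L := by
    intro j
    have h1 := norm_le_pi_norm (rc (γ - η • w) - rc κ) j
    rw [dist_eq_norm] at hd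
    have h2 := (Real.norm_eq_abs _ ▸ h1).trans hd.le
    have e : (rc (γ - η • w) - rc κ) j = (((γ - η • w - κ) j : ℚ) : ℝ) := by simp [rc]
    rw [e] at h2
    exact_mod_cast h2
  obtain ⟨a, ha, hsum⟩ := hsol (η / L) _ hy'
  have e : γ = κ + ∑ i : Fin (K + 1), (η + a i) • (fun j : Fin (K + 1) => ((i : ℕ) : ℚ) ^ (2 * (j : ℕ))) := by
    ext j
    have h1 := hsum j
    simp only [Pi.sub_apply, Pi.smul_apply, smul_eq_mul, hw, Finset.mul_sum] at h1
    simp only [Pi.add_apply, Finset.sum_apply, Pi.smul_apply, smul_eq_mul, add_mul, Finset.sum_add_distrib]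
    linarith
  rw [e]
  refine CQ_add hκ (CQ_sum _ _ (fun i _ => CQ_smul (CQ_vec _) _ ?_))
  have := ha i
  rw [div_mul_cancel₀ _ hL.ne', abs_le] at this
  linarith

lemma clear_den (S : Multiset ℚ) : ∃ D : ℕ, 0 < D ∧ ∃ T : Multiset ℤ,
    S.map (fun q => (D : ℚ) * q) = T.map (fun z : ℤ => (z : ℚ)) := by
  induction S using Multiset.induction_on with
  | empty => exact ⟨1, one_pos, 0, by simp⟩
  | cons a S ih =>
    obtain ⟨D, hD, T, hT⟩ := ih
    refine ⟨D * a.den, by have := a.den_pos; positivity,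
      (D * a.num) ::ₘ T.map (fun z : ℤ => z * (a.den : ℤ)), ?_⟩
    rw [Multiset.map_cons, Multiset.map_cons, Multiset.map_map]
    congr 1
    · push_cast; rw [mul_assoc, Rat.den_mul_eq_num]
    · have h1 := congrArg (Multiset.map (fun q : ℚ => q * a.den)) hT
      rw [Multiset.map_map, Multiset.map_map] at h1
      convert h1 using 2
      · simp; ring
      · simp

/-- One-dimensional design. -/
lemma design1 (K : ℕ) : ∃ (q : Multiset ℤ) (a l : ℚ), 0 < a ∧ 0 < l ∧ q ≠ 0 ∧ ∀ j ≤ K,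
    (q.map (fun u : ℤ => (u : ℚ) ^ (2 * j))).sum = a * l ^ j * gm j ∧
    (q.map (fun u : ℤ => (u : ℚ) ^ (2 * j + 1))).sum = 0 := by
  obtain ⟨N, hN, S, hS⟩ := gm_mem_CQ K
  obtain ⟨D, hD, T, hT⟩ := clear_den S
  have hN' : (0 : ℚ) < N := by exact_mod_cast hN
  have hD' : (0 : ℚ) < D := by exact_mod_cast hD
  have hT2 : ∀ j ≤ K, (T.map (fun u : ℤ => (u : ℚ) ^ (2 * j))).sum = N * (D ^ 2 : ℚ) ^ j * gm j := by
    intro j hj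
    have h1 := hS ⟨j, by omega⟩
    simp only at h1
    have h2 : T.map (fun u : ℤ => (u : ℚ) ^ (2 * j)) =
        (T.map (fun z : ℤ => (z : ℚ))).map (fun x => x ^ (2 * j)) := by
      rw [Multiset.map_map]; rfl
    rw [h2, ← hT, Multiset.map_map]
    have h3 : S.map ((fun x : ℚ => x ^ (2 * j)) ∘ fun q => (D : ℚ) * q) =
        S.map (fun q => (D : ℚ) ^ (2 * j) * q ^ (2 * j)) := by
      refine Multiset.map_congr rfl (fun q _ => ?_)
      simp [mul_pow]
    rw [h3, Multiset.sum_map_mul_left, ← h1, pow_mul]; ring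
  refine ⟨T + T.map (fun z : ℤ => -z), 2 * N, (D : ℚ) ^ 2, by positivity, by positivity, ?_, fun j hj => ⟨?_, ?_⟩⟩
  · intro h0
    have h1 : T = 0 := (add_eq_zero_iff_of_nonneg (Multiset.zero_le _) (Multiset.zero_le _)).1 h0 |>.1
    have h2 := hT2 0 (Nat.zero_le _)
    rw [h1] at h2
    simp at h2
    have := gm_pos 0
    rcases h2 with h2 | h2 <;> first | omega | linarith
  · rw [Multiset.map_add, Multiset.sum_add, Multiset.map_map]
    have : T.map ((fun u : ℤ => (u : ℚ) ^ (2 * j)) ∘ fun z => -z) = T.map (fun u : ℤ => (u : ℚ) ^ (2 * j)) := by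
      refine Multiset.map_congr rfl (fun q _ => ?_)
      simp
    rw [this, hT2 j hj]; ring
  · rw [Multiset.map_add, Multiset.sum_add, Multiset.map_map]
    have : T.map ((fun u : ℤ => (u : ℚ) ^ (2 * j + 1)) ∘ fun z => -z) =
        T.map (fun u : ℤ => -(u : ℚ) ^ (2 * j + 1)) := by
      refine Multiset.map_congr rfl (fun q _ => ?_)
      have : Odd (2 * j + 1) := ⟨j, rfl⟩
      simp [this.neg_pow]
    rw [this, ← Multiset.sum_map_add]; simp

/-- Gaussian moments with variance parameter. -/
def mu (k : ℕ) (s : ℚ) : ℚ := if Even k then s ^ (k / 2) * gm (k / 2) else 0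

lemma mu_even (j : ℕ) (s : ℚ) : mu (2 * j) s = s ^ j * gm j := by
  simp [mu]

lemma mu_odd (j : ℕ) (s : ℚ) : mu (2 * j + 1) s = 0 := by
  simp [mu]

lemma mu_dil (k : ℕ) (x s : ℚ) : x ^ k * mu k s = mu k (x ^ 2 * s) := by
  rcases Nat.even_or_odd' k with ⟨j, rfl | rfl⟩
  · rw [mu_even, mu_even, mul_pow, pow_mul]; ring
  · rw [mu_odd, mu_odd, mul_zero]

lemma sum_even_only (f : ℕ → ℚ) (hf : ∀ j, f (2 * j + 1) = 0) (m : ℕ) :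
    ∑ i ∈ range (2 * m + 1), f i = ∑ i ∈ range (m + 1), f (2 * i) := by
  induction m with
  | zero => simp
  | succ m ih =>
    rw [show 2 * (m + 1) + 1 = (2 * m + 1) + 1 + 1 by ring, Finset.sum_range_succ,
      Finset.sum_range_succ, ih, hf, Finset.sum_range_succ _ (m + 1)]
    ring_nf

lemma gm_choose (m i : ℕ) (hi : i ≤ m) :
    ((2 * m).choose (2 * i) : ℚ) * (gm i * gm (m - i)) = gm m * (m.choose i : ℚ) := by
  rw [Nat.cast_choose ℚ hi, Nat.cast_choose ℚ (by omega : 2 * i ≤ 2 * m)]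
  obtain ⟨d, rfl⟩ := Nat.exists_eq_add_of_le hi
  rw [show 2 * (i + d) - 2 * i = 2 * d by omega, show i + d - i = d by omega]
  unfold gm
  have h1 := Nat.factorial_pos (2 * i)
  have h2 := Nat.factorial_pos (2 * d)
  have h3 := Nat.factorial_pos (i)
  have h4 := Nat.factorial_pos (d)
  have h5 := Nat.factorial_pos (i + d)
  field_simp
  rw [pow_add]

lemma mu_add (k : ℕ) (s t : ℚ) :
    ∑ i ∈ range (k + 1), mu i s * mu (k - i) t * (k.choose i : ℚ) = mu k (s + t) := by
  rcases Nat.even_or_odd' k with ⟨m, rfl | rfl⟩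
  · rw [sum_even_only _ (fun j => by rw [mu_odd]; ring), mu_even, add_pow, Finset.sum_mul]
    refine Finset.sum_congr rfl (fun i hi => ?_)
    have hi : i ≤ m := by simpa [Nat.lt_succ_iff] using hi
    rw [show 2 * m - 2 * i = 2 * (m - i) by omega, mu_even, mu_even]
    have := gm_choose m i hi
    linear_combination s ^ i * t ^ (m - i) * this
  · rw [mu_odd]
    refine Finset.sum_eq_zero (fun i hi => ?_)
    have hi : i ≤ 2 * m + 1 := by simpa [Nat.lt_succ_iff] using hi
    rcases Nat.even_or_odd' i with ⟨a, rfl | rfl⟩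
    · rw [show 2 * m + 1 - 2 * a = 2 * (m - a) + 1 by omega, mu_odd]; ring
    · rw [mu_odd]; ring

/-- `A` has Gaussian moments up to order `K`. -/
def IsG (K : ℕ) (A : Multiset ℤ) (a s : ℚ) : Prop :=
  ∀ k ≤ K, (A.map (fun u : ℤ => (u : ℚ) ^ k)).sum = a * mu k s

lemma IsG.dil {K : ℕ} {A : Multiset ℤ} {a s : ℚ} (h : IsG K A a s) (x : ℤ) :
    IsG K (A.map (fun u => x * u)) a ((x : ℚ) ^ 2 * s) := by
  intro k hk
  rw [Multiset.map_map]
  have e : A.map ((fun u : ℤ => (u : ℚ) ^ k) ∘ fun u => x * u) =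
      A.map (fun u : ℤ => (x : ℚ) ^ k * (u : ℚ) ^ k) := by
    refine Multiset.map_congr rfl (fun u _ => ?_)
    simp [mul_pow]
  rw [e, Multiset.sum_map_mul_left, h k hk, ← mu_dil]; ring

/-- sumset with multiplicity -/
def msum (A B : Multiset ℤ) : Multiset ℤ := A.bind (fun u => B.map (fun v => u + v))

lemma card_msum (A B : Multiset ℤ) : (msum A B).card = A.card * B.card := by
  simp [msum, Multiset.card_bind]

lemma msum_sq {A B : Multiset ℤ} {α β : ℤ} (hA : ∀ u ∈ A, u ^ 2 ≤ α) (hB : ∀ u ∈ B, u ^ 2 ≤ β) :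
    ∀ u ∈ msum A B, u ^ 2 ≤ 2 * (α + β) := by
  intro w hw
  simp only [msum, Multiset.mem_bind, Multiset.mem_map] at hw
  obtain ⟨u, hu, v, hv, rfl⟩ := hw
  nlinarith [hA u hu, hB v hv, sq_nonneg (u - v)]

lemma sum_map_finset_sum {α : Type*} (A : Multiset α) (s : Finset ℕ) (g : ℕ → α → ℚ) :
    (A.map (fun u => ∑ i ∈ s, g i u)).sum = ∑ i ∈ s, (A.map (fun u => g i u)).sum := by
  induction A using Multiset.induction_on with
  | empty => simp
  | cons a A ih => simp [ih, Finset.sum_add_distrib]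

lemma IsG.add {K : ℕ} {A B : Multiset ℤ} {a s b t : ℚ} (hA : IsG K A a s) (hB : IsG K B b t) :
    IsG K (msum A B) (a * b) (s + t) := by
  intro k hk
  rw [msum, Multiset.map_bind, Multiset.sum_bind]
  have e : ∀ u : ℤ, ((B.map (fun v => u + v)).map (fun w : ℤ => (w : ℚ) ^ k)).sum =
      ∑ i ∈ range (k + 1), (u : ℚ) ^ i * (b * mu (k - i) t * (k.choose i : ℚ)) := by
    intro u
    rw [Multiset.map_map]
    have e1 : B.map ((fun w : ℤ => (w : ℚ) ^ k) ∘ fun v => u + v) =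
      B.map (fun v : ℤ => ∑ i ∈ range (k + 1), ((u : ℚ) ^ i * (k.choose i : ℚ)) * (v : ℚ) ^ (k - i)) := by
      refine Multiset.map_congr rfl (fun v _ => ?_)
      simp only [Function.comp]
      push_cast
      rw [add_pow]
      exact Finset.sum_congr rfl (fun i _ => by ring)
    rw [e1, sum_map_finset_sum]
    refine Finset.sum_congr rfl (fun i _ => ?_)
    rw [Multiset.sum_map_mul_left, hB (k - i) (by omega)]; ring
  simp only [e]
  rw [sum_map_finset_sum, ← mu_add, Finset.mul_sum]
  refine Finset.sum_congr rfl (fun i hi => ?_)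
  have hi : i ≤ k := by simpa [Nat.lt_succ_iff] using hi
  rw [Multiset.sum_map_mul_right, hA i (by omega)]; ring

lemma mset_sq_bound (q : Multiset ℤ) : ∃ U : ℕ, 0 < U ∧ ∀ u ∈ q, u ^ 2 ≤ (U : ℤ) := by
  induction q using Multiset.induction_on with
  | empty => exact ⟨1, one_pos, by simp⟩
  | cons a q ih =>
    obtain ⟨U, hU, h⟩ := ih
    refine ⟨U + (a ^ 2).toNat, by omega, fun u hu => ?_⟩
    have h0 : (((a ^ 2).toNat : ℕ) : ℤ) = a ^ 2 := Int.toNat_of_nonneg (sq_nonneg a)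
    push_cast
    rw [h0]
    rcases Multiset.mem_cons.1 hu with rfl | hu
    · omega
    · have := h u hu; have := sq_nonneg a; omega

/-- Hilbert-type design. -/
lemma design4 (K : ℕ) : ∃ (s B : ℕ) (C : ℕ → ℝ), 0 < s ∧ 0 < B ∧ (∀ j, 0 < C j) ∧
    ∀ m : ℕ, ∃ S : Multiset ℤ, S.card = s ∧ (∀ h ∈ S, h ^ 2 ≤ (B : ℤ) * m) ∧
      ∀ j ≤ K, (S.map (fun h : ℤ => (h : ℝ) ^ (2 * j))).sum = C j * (m : ℝ) ^ j ∧
        (S.map (fun h : ℤ => (h : ℝ) ^ (2 * j + 1))).sum = 0 := by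
  obtain ⟨q, a, l, ha, hl, hq, hmom⟩ := design1 K
  obtain ⟨U, hU, hUq⟩ := mset_sq_bound q
  have hG : IsG (2 * K + 1) q a l := by
    intro k hk
    rcases Nat.even_or_odd' k with ⟨j, rfl | rfl⟩
    · rw [(hmom j (by omega)).1, mu_even]; ring
    · rw [(hmom j (by omega)).2, mu_odd, mul_zero]
  have hcard : 0 < q.card := Multiset.card_pos.2 hq
  refine ⟨q.card * q.card * (q.card * q.card), 4 * U,
    fun j => ((a * a * (a * a) * (l ^ j * gm j) : ℚ) : ℝ), by positivity, by omega, fun j => ?_, fun m => ?_⟩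
  · have := gm_pos j
    have h2 : 0 < a * a * (a * a) * (l ^ j * gm j) := by positivity
    exact Rat.cast_pos.2 h2
  obtain ⟨x1, x2, x3, x4, hx⟩ := Nat.sum_four_squares m
  set d : ℕ → Multiset ℤ := fun x => q.map (fun u => (x : ℤ) * u) with hd
  have hdG : ∀ x : ℕ, IsG (2 * K + 1) (d x) a ((((x : ℤ)) : ℚ) ^ 2 * l) := fun x => hG.dil _
  have hdB : ∀ x : ℕ, ∀ u ∈ d x, u ^ 2 ≤ (U : ℤ) * x ^ 2 := by
    intro x u hu
    simp only [hd, Multiset.mem_map] at hu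
    obtain ⟨v, hv, rfl⟩ := hu
    rw [mul_pow]
    nlinarith [hUq v hv, sq_nonneg (x : ℤ)]
  have hdc : ∀ x, (d x).card = q.card := fun x => by simp [hd]
  have hS := ((hdG x1).add (hdG x2)).add ((hdG x3).add (hdG x4))
  refine ⟨msum (msum (d x1) (d x2)) (msum (d x3) (d x4)), by simp [card_msum, hdc], ?_, ?_⟩
  · intro h hh
    have := msum_sq (msum_sq (hdB x1) (hdB x2)) (msum_sq (hdB x3) (hdB x4)) h hh
    rw [← hx]
    push_cast
    linarith
  · have hv : (((x1 : ℤ) : ℚ) ^ 2 * l + ((x2 : ℤ) : ℚ) ^ 2 * l + (((x3 : ℤ) : ℚ) ^ 2 * l + ((x4 : ℤ) : ℚ) ^ 2 * l)) = m * l := by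
      rw [← hx]; push_cast; ring
    rw [hv] at hS
    have cast : ∀ (S : Multiset ℤ) (k : ℕ), (S.map (fun h : ℤ => (h : ℝ) ^ k)).sum =
        (((S.map (fun h : ℤ => (h : ℚ) ^ k)).sum : ℚ) : ℝ) := by
      intro S k
      induction S using Multiset.induction_on with
      | empty => simp
      | cons b S ih =>
        rw [Multiset.map_cons, Multiset.sum_cons, ih, Multiset.map_cons, Multiset.sum_cons]
        push_cast; ring
    intro j hj
    constructor
    · rw [cast, hS (2 * j) (by omega), mu_even]
      push_cast; ring
    · rw [cast, hS (2 * j + 1) (by omega), mu_odd]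
      simp

/-- Polynomials of degree at most `D` whose coefficients have prescribed size. -/
def Cls (P : Polynomial ℝ) (D : ℕ) (S Y U : ℝ) : Prop :=
  P.natDegree ≤ D ∧ ∀ j, 1 ≤ j → j ≤ D →
    S / (U * Y ^ j) ≤ |P.coeff j| ∧ |P.coeff j| ≤ S * U / Y ^ j

lemma taylor_coeff_sum (P : Polynomial ℝ) (D : ℕ) (hP : P.natDegree ≤ D) (n0 : ℝ) (k : ℕ) :
    (Polynomial.taylor n0 P).coeff k =
      ∑ i ∈ range (D + 1), (i.choose k : ℝ) * P.coeff i * n0 ^ (i - k) := by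
  rw [Polynomial.taylor_coeff, Polynomial.hasseDeriv_apply, Polynomial.eval_sum,
    Polynomial.sum_over_range' _ _ (D + 1) (by omega)]
  · refine Finset.sum_congr rfl (fun i _ => ?_)
    rw [Polynomial.eval_monomial]
  · intro i; simp

lemma taylor_close {P : Polynomial ℝ} {D : ℕ} {S Y U V n0 : ℝ} (h : Cls P D S Y U)
    (hS : 0 < S) (hU : 1 ≤ U) (hY : 0 < Y) (hV1 : 1 ≤ V) (hV : 4 * ((D + 1) * 2 ^ D) * U ^ 2 ≤ V)
    (h0 : 0 ≤ n0) (hn : n0 ≤ Y / V) (k : ℕ) (hk : 1 ≤ k) (hkD : k ≤ D) :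
    |(Polynomial.taylor n0 P).coeff k - P.coeff k| ≤ S / (4 * U * Y ^ k) := by
  have hV0 : 0 < V := by linarith
  have hU0 : 0 < U := by linarith
  rw [taylor_coeff_sum P D h.1]
  have e : ∑ i ∈ range (D + 1), (i.choose k : ℝ) * P.coeff i * n0 ^ (i - k) - P.coeff k =
      ∑ i ∈ range (D + 1), if i = k then 0 else (i.choose k : ℝ) * P.coeff i * n0 ^ (i - k) := by
    have h1 : P.coeff k = ∑ i ∈ range (D + 1), if i = k then P.coeff k else 0 := by
      rw [Finset.sum_ite_eq' (range (D + 1)) k]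
      rw [if_pos (by simp; omega)]
    rw [h1, ← Finset.sum_sub_distrib]
    refine Finset.sum_congr rfl (fun i _ => ?_)
    split_ifs with hik
    · subst hik; simp
    · ring
  rw [e]
  have hterm : ∀ i ∈ range (D + 1),
      |if i = k then 0 else (i.choose k : ℝ) * P.coeff i * n0 ^ (i - k)| ≤ 2 ^ D * (S * U / (Y ^ k * V)) := by
    intro i hi
    have hiD : i ≤ D := by simpa [Nat.lt_succ_iff] using hi
    split_ifs with hik
    · simp; positivity
    rcases lt_or_ge i k with hlt | hge
    · rw [Nat.choose_eq_zero_of_lt hlt]; simp; positivity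
    have hgt : k < i := lt_of_le_of_ne hge (Ne.symm hik)
    rw [abs_mul, abs_mul, abs_of_nonneg (pow_nonneg h0 _), Nat.abs_cast, mul_assoc]
    have hc : ((i.choose k : ℕ) : ℝ) ≤ 2 ^ D := by
      have h1 : i.choose k ≤ 2 ^ i := Nat.choose_le_two_pow i k
      have h2 : 2 ^ i ≤ 2 ^ D := Nat.pow_le_pow_right (by norm_num) hiD
      exact_mod_cast h1.trans h2
    refine mul_le_mul hc ?_ (by positivity) (by positivity)
    have hcf := (h.2 i (by omega) hiD).2
    calc |P.coeff i| * n0 ^ (i - k) ≤ S * U / Y ^ i * (Y / V) ^ (i - k) :=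
          mul_le_mul hcf (pow_le_pow_left₀ h0 hn _) (by positivity) (by positivity)
      _ = S * U / (Y ^ k * V ^ (i - k)) := by
          obtain ⟨d, rfl⟩ := Nat.exists_eq_add_of_le hge
          rw [show k + d - k = d by omega, div_pow, pow_add]
          field_simp
      _ ≤ S * U / (Y ^ k * V) := by
          have : V ≤ V ^ (i - k) := le_self_pow₀ hV1 (by omega)
          gcongr
  calc _ ≤ ∑ i ∈ range (D + 1), |if i = k then 0 else (i.choose k : ℝ) * P.coeff i * n0 ^ (i - k)| :=
        Finset.abs_sum_le_sum_abs _ _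
    _ ≤ ∑ i ∈ range (D + 1), 2 ^ D * (S * U / (Y ^ k * V)) := Finset.sum_le_sum hterm
    _ = ((D + 1) * 2 ^ D) * (S * U / (Y ^ k * V)) := by
        rw [Finset.sum_const, Finset.card_range, nsmul_eq_mul]; push_cast; ring
    _ ≤ S / (4 * U * Y ^ k) := by
        rw [← mul_div_assoc, div_le_div_iff₀ (by positivity) (by positivity)]
        have : (0 : ℝ) < S * Y ^ k := by positivity
        nlinarith [mul_le_mul_of_nonneg_left hV this.le]

/-- The averaging operator on polynomials. -/
noncomputable def EE (C : ℕ → ℝ) (n0 : ℝ) (P : Polynomial ℝ) : Polynomial ℝ :=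
  ∑ j ∈ range (P.natDegree / 2 + 1),
    Polynomial.monomial j (C j * (Polynomial.taylor n0 P).coeff (2 * j))

lemma EE_coeff (C : ℕ → ℝ) (n0 : ℝ) (P : Polynomial ℝ) (j : ℕ) :
    (EE C n0 P).coeff j = C j * (Polynomial.taylor n0 P).coeff (2 * j) := by
  rw [EE, Polynomial.finsetSum_coeff]
  simp only [Polynomial.coeff_monomial]
  rw [Finset.sum_ite_eq']
  split_ifs with h
  · rfl
  · rw [Polynomial.coeff_eq_zero_of_natDegree_lt, mul_zero]
    rw [Polynomial.natDegree_taylor]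
    simp at h
    omega

lemma EE_natDegree (C : ℕ → ℝ) (n0 : ℝ) (P : Polynomial ℝ) :
    (EE C n0 P).natDegree ≤ P.natDegree / 2 := by
  rw [EE]
  refine Polynomial.natDegree_sum_le_of_forall_le _ _ (fun j hj => ?_)
  refine (Polynomial.natDegree_monomial_le _).trans ?_
  simpa [Nat.lt_succ_iff] using hj

lemma sum_range_two_mul (f : ℕ → ℝ) (L : ℕ) :
    ∑ k ∈ range (2 * L), f k = ∑ j ∈ range L, (f (2 * j) + f (2 * j + 1)) := by
  induction L with
  | zero => simp
  | succ L ih =>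
    rw [show 2 * (L + 1) = 2 * L + 1 + 1 by ring, Finset.sum_range_succ, Finset.sum_range_succ, ih,
      Finset.sum_range_succ _ L]
    ring

lemma sum_map_finset_sumR {α : Type*} (A : Multiset α) (s : Finset ℕ) (g : ℕ → α → ℝ) :
    (A.map (fun u => ∑ i ∈ s, g i u)).sum = ∑ i ∈ s, (A.map (fun u => g i u)).sum := by
  induction A using Multiset.induction_on with
  | empty => simp
  | cons a A ih => simp [ih, Finset.sum_add_distrib]

lemma EE_eval {K : ℕ} {C : ℕ → ℝ} {S : Multiset ℤ} {m : ℕ}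
    (hS : ∀ j ≤ K, (S.map (fun h : ℤ => (h : ℝ) ^ (2 * j))).sum = C j * (m : ℝ) ^ j ∧
        (S.map (fun h : ℤ => (h : ℝ) ^ (2 * j + 1))).sum = 0)
    (n0 : ℝ) (P : Polynomial ℝ) (hP : P.natDegree ≤ K) :
    (S.map (fun h : ℤ => P.eval (n0 + h))).sum = (EE C n0 P).eval (m : ℝ) := by
  set L := P.natDegree / 2 with hL
  have h1 : ∀ h : ℤ, P.eval (n0 + h) =
      ∑ k ∈ range (2 * (L + 1)), (Polynomial.taylor n0 P).coeff k * (h : ℝ) ^ k := by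
    intro h
    rw [add_comm, ← Polynomial.taylor_eval, Polynomial.eval_eq_sum_range']
    rw [Polynomial.natDegree_taylor]; omega
  simp only [h1]
  rw [sum_map_finset_sumR, sum_range_two_mul, EE, Polynomial.eval_finsetSum]
  refine Finset.sum_congr rfl (fun j hj => ?_)
  have hj : j ≤ L := by simpa [Nat.lt_succ_iff] using hj
  rw [Multiset.sum_map_mul_left, Multiset.sum_map_mul_left, (hS j (by omega)).1, (hS j (by omega)).2,
    Polynomial.eval_monomial]
  ring

lemma EE_Cls {P : Polynomial ℝ} {D : ℕ} {S Y U V n0 κ : ℝ} {C : ℕ → ℝ} (h : Cls P D S Y U)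
    (hS : 0 < S) (hU : 1 ≤ U) (hY : 0 < Y) (hV1 : 1 ≤ V) (hV : 4 * ((D + 1) * 2 ^ D) * U ^ 2 ≤ V)
    (h0 : 0 ≤ n0) (hn : n0 ≤ Y / V) (hκ : 0 < κ) (hC : ∀ j ≤ D, 2 / κ ≤ C j ∧ 2 * C j ≤ κ) :
    Cls (EE C n0 P) (D / 2) S (Y ^ 2) (κ * U) := by
  have hU0 : 0 < U := by linarith
  refine ⟨(EE_natDegree C n0 P).trans (Nat.div_le_div_right h.1), fun j hj hjD => ?_⟩
  have h1 := taylor_close h hS hU hY hV1 hV h0 hn (2 * j) (by omega) (by omega)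
  obtain ⟨h2, h3⟩ := h.2 (2 * j) (by omega) (by omega)
  obtain ⟨h4, h5⟩ := hC j (by omega)
  have hC0 : 0 < C j := lt_of_lt_of_le (by positivity) h4
  rw [EE_coeff, abs_mul, abs_of_pos hC0]
  set t := (Polynomial.taylor n0 P).coeff (2 * j)
  set p := P.coeff (2 * j)
  have hY2 : (Y ^ 2) ^ j = Y ^ (2 * j) := by rw [pow_mul]
  rw [hY2]
  set W := Y ^ (2 * j) with hW
  have hW0 : 0 < W := by positivity
  have e1 : S / (4 * U * W) = (S / (U * W)) / 4 := by field_simp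
  rw [e1] at h1
  have h6 : |p| - |t| ≤ S / (U * W) / 4 := (abs_sub_abs_le_abs_sub p t).trans (by rwa [abs_sub_comm])
  have h7 : |t| - |p| ≤ S / (U * W) / 4 := (abs_sub_abs_le_abs_sub t p).trans h1
  have h8 : S / (U * W) ≤ S * U / W := h2.trans h3
  have h9 : 0 < S / (U * W) := by positivity
  constructor
  · have ht : S / (U * W) / 2 ≤ |t| := by linarith
    calc S / (κ * U * W) = (2 / κ) * (S / (U * W) / 2) := by field_simp
      _ ≤ C j * |t| := mul_le_mul h4 ht (by positivity) hC0.le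
  · have ht : |t| ≤ 2 * (S * U / W) := by linarith
    calc C j * |t| ≤ C j * (2 * (S * U / W)) := mul_le_mul_of_nonneg_left ht hC0.le
      _ = (2 * C j) * (S * U / W) := by ring
      _ ≤ κ * (S * U / W) := mul_le_mul_of_nonneg_right h5 (by positivity)
      _ = S * (κ * U) / W := by ring

lemma incr_close {P : Polynomial ℝ} {D : ℕ} {S Y U V : ℝ} (h : Cls P D S Y U) (hD : 1 ≤ D)
    (hS : 0 < S) (hU : 1 ≤ U) (hV1 : 1 ≤ V) (hV : 4 * ((D + 1) * 2 ^ D) * U ^ 2 ≤ V) (hYV : 2 * V ≤ Y)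
    (n0 : ℝ) (h0 : 0 ≤ n0) (hn : n0 ≤ Y / V) :
    |P.eval (n0 + 1) - P.eval n0 - P.coeff 1| ≤ S / (2 * U * Y) := by
  have hU0 : 0 < U := by linarith
  have hY : 0 < Y := by linarith
  have hdeg : (Polynomial.taylor n0 P).natDegree < D + 1 := by
    rw [Polynomial.natDegree_taylor]; have := h.1; omega
  have e1 : P.eval (n0 + 1) = ∑ k ∈ range (D + 1), (Polynomial.taylor n0 P).coeff k := by
    rw [add_comm, ← Polynomial.taylor_eval, Polynomial.eval_eq_sum_range' hdeg]
    simp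
  have e2 : P.eval n0 = (Polynomial.taylor n0 P).coeff 0 := by
    rw [Polynomial.taylor_coeff_zero]
  obtain ⟨D', rfl⟩ : ∃ D', D = D' + 1 := ⟨D - 1, by omega⟩
  rw [e1, e2, Finset.sum_range_succ', Finset.sum_range_succ']
  have e3 : ∀ a b c d : ℝ, a + b + c - c - d = a + (b - d) := fun _ _ _ _ => by ring
  rw [e3]
  have h1 := taylor_close h hS hU hY hV1 hV h0 hn 1 le_rfl (by omega)
  have h2 : |∑ k ∈ range D', (Polynomial.taylor n0 P).coeff (k + 1 + 1)| ≤ S / (4 * U * Y) := by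
    have hterm : ∀ k ∈ range D', |(Polynomial.taylor n0 P).coeff (k + 1 + 1)| ≤ 2 * S * U / Y ^ 2 := by
      intro k hk
      have hk : k < D' := by simpa using hk
      have g1 := taylor_close h hS hU hY hV1 hV h0 hn (k + 1 + 1) (by omega) (by omega)
      obtain ⟨g2, g3⟩ := h.2 (k + 1 + 1) (by omega) (by omega)
      set t := (Polynomial.taylor n0 P).coeff (k + 1 + 1)
      set p := P.coeff (k + 1 + 1)
      set W := Y ^ (k + 1 + 1) with hW
      have hW0 : 0 < W := by positivity
      have e1 : S / (4 * U * W) = (S / (U * W)) / 4 := by field_simp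
      rw [e1] at g1
      have h7 : |t| - |p| ≤ S / (U * W) / 4 := (abs_sub_abs_le_abs_sub t p).trans g1
      have h8 : S / (U * W) ≤ S * U / W := g2.trans g3
      have h9 : 0 < S / (U * W) := by positivity
      have h10 : |t| ≤ 2 * S * U / W := by
        have : 2 * S * U / W = 2 * (S * U / W) := by ring
        rw [this]; linarith
      refine h10.trans ?_
      have : Y ^ 2 ≤ W := pow_le_pow_right₀ (by linarith) (by omega)
      gcongr
    calc _ ≤ ∑ k ∈ range D', |(Polynomial.taylor n0 P).coeff (k + 1 + 1)| := Finset.abs_sum_le_sum_abs _ _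
      _ ≤ ∑ k ∈ range D', 2 * S * U / Y ^ 2 := Finset.sum_le_sum hterm
      _ = D' * (2 * S * U / Y ^ 2) := by rw [Finset.sum_const, Finset.card_range, nsmul_eq_mul]
      _ ≤ S / (4 * U * Y) := by
        rw [← mul_div_assoc, div_le_div_iff₀ (by positivity) (by positivity)]
        have h5 : (1 : ℝ) ≤ 2 ^ (D' + 1) := one_le_pow₀ (by norm_num)
        have h6 : (D' : ℝ) * U ^ 2 * 8 ≤ Y := by
          push_cast at hV
          have h7 : 0 ≤ ((D' : ℝ) + 1 + 1) * U ^ 2 := by positivity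
          nlinarith [mul_le_mul_of_nonneg_left h5 h7, sq_nonneg U]
        have h8 : (0 : ℝ) < S * Y := by positivity
        nlinarith [mul_le_mul_of_nonneg_left h6 h8.le]
  calc _ ≤ _ := abs_add_le _ _
    _ ≤ S / (4 * U * Y) + S / (4 * U * Y) := by
      refine add_le_add h2 ?_
      simpa using h1
    _ = S / (2 * U * Y) := by field_simp; norm_num

lemma cover_seq (a : ℕ → ℝ) (lo g : ℝ) (hlo : 0 ≤ lo) (M : ℕ)
    (hst : ∀ m < M, lo ≤ a (m + 1) - a m ∧ a (m + 1) - a m ≤ g) (ρ : ℝ) (hg : 0 ≤ g)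
    (hρ : |ρ| ≤ ((M / 2 : ℕ) : ℝ) * lo) : ∃ m ≤ M, |a m - a (M / 2) - ρ| ≤ g := by
  have hgrow : ∀ d m, m + d ≤ M → (d : ℝ) * lo ≤ a (m + d) - a m := by
    intro d
    induction d with
    | zero => intro m _; simp
    | succ d ih =>
      intro m hm
      have h1 := ih m (by omega)
      have h2 := (hst (m + d) (by omega)).1
      rw [show m + (d + 1) = m + d + 1 by ring]
      push_cast
      linarith
  have h1 := hgrow (M / 2) 0 (by omega)
  have h2 := hgrow (M - M / 2) (M / 2) (by omega)
  rw [zero_add] at h1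
  rw [show M / 2 + (M - M / 2) = M by omega] at h2
  have h3 : ((M / 2 : ℕ) : ℝ) * lo ≤ ((M - M / 2 : ℕ) : ℝ) * lo := by
    refine mul_le_mul_of_nonneg_right ?_ hlo
    exact_mod_cast (by omega : M / 2 ≤ M - M / 2)
  rw [abs_le] at hρ
  obtain ⟨m, hm, h4⟩ := discrete_ivt a g hg M (fun m hm => by
    have := hst m hm
    rw [abs_of_nonneg (by linarith)]; exact this.2) (a (M / 2) + ρ)
    (Or.inl ⟨by linarith, by linarith⟩)
  exact ⟨m, hm, by rw [sub_sub]; exact h4⟩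

/-- Coverage lemma. -/
lemma cover {P : Polynomial ℝ} {D : ℕ} {S Y U V : ℝ} (h : Cls P D S Y U) (hD : 1 ≤ D)
    (hS : 0 < S) (hU : 1 ≤ U) (hV1 : 1 ≤ V) (hV : 4 * ((D + 1) * 2 ^ D) * U ^ 2 ≤ V) (hYV : 2 * V ≤ Y)
    (M : ℕ) (hM : (M : ℝ) ≤ Y / V) (ρ : ℝ)
    (hρ : |ρ| ≤ ((M / 2 : ℕ) : ℝ) * (S / (2 * U * Y))) :
    ∃ m ≤ M, |P.eval (m : ℝ) - P.eval ((M / 2 : ℕ) : ℝ) - ρ| ≤ 2 * S * U / Y := by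
  have hU0 : 0 < U := by linarith
  have hY : 0 < Y := by linarith
  obtain ⟨c1, c2⟩ := h.2 1 le_rfl hD
  rw [pow_one] at c1 c2
  have e1 : S / (U * Y) = 2 * (S / (2 * U * Y)) := by field_simp
  rw [e1] at c1
  have hx0 : 0 < S / (2 * U * Y) := by positivity
  have e2 : 2 * S * U / Y = 2 * (S * U / Y) := by ring
  have hx1 : 0 < S * U / Y := by positivity
  have hinc : ∀ m < M, |P.eval ((m : ℝ) + 1) - P.eval (m : ℝ) - P.coeff 1| ≤ S / (2 * U * Y) := by
    intro m hm
    refine incr_close h hD hS hU hV1 hV hYV _ (Nat.cast_nonneg m) (le_trans ?_ hM)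
    exact_mod_cast hm.le
  rcases le_or_gt 0 (P.coeff 1) with hs | hs
  · rw [abs_of_nonneg hs] at c1 c2
    refine cover_seq (fun m => P.eval (m : ℝ)) _ _ hx0.le M (fun m hm => ?_) ρ (by positivity) hρ
    have := hinc m hm
    rw [abs_le] at this
    push_cast
    rw [e2]
    constructor <;> linarith
  · rw [abs_of_neg hs] at c1 c2
    obtain ⟨m, hm, h4⟩ := cover_seq (fun m => - P.eval (m : ℝ)) _ (2 * S * U / Y) hx0.le M (fun m hm => by
      have := hinc m hm
      rw [abs_le] at this
      push_cast
      rw [e2]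
      constructor <;> linarith) (-ρ) (by positivity) (by rwa [abs_neg])
    refine ⟨m, hm, ?_⟩
    rw [← abs_neg]
    have e3 : -(P.eval (m : ℝ) - P.eval ((M / 2 : ℕ) : ℝ) - ρ) =
      -P.eval (m : ℝ) - -P.eval ((M / 2 : ℕ) : ℝ) - -ρ := by ring
    rw [e3]; exact h4

/-- lengths of the ranges at the successive stages -/
def Mr (B M0 : ℕ) : ℕ → ℕ
  | 0 => M0
  | r + 1 => (Mr B M0 r / 2) ^ 2 / B

/-- offsets at the successive stages -/
def Sr (Sd : ℕ → Multiset ℤ) (B M0 : ℕ) : ℕ → ℕ → Multiset ℕ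
  | 0, m => {m}
  | r + 1, m => (Sd m).bind (fun h => Sr Sd B M0 r (((Mr B M0 r / 2 : ℕ) : ℤ) + h).toNat)

/-- polynomials at the successive stages -/
noncomputable def Er (C : ℕ → ℝ) (B M0 : ℕ) (P : Polynomial ℝ) : ℕ → Polynomial ℝ
  | 0 => P
  | r + 1 => EE C ((Mr B M0 r / 2 : ℕ) : ℝ) (Er C B M0 P r)

lemma Sr_card {Sd : ℕ → Multiset ℤ} {B M0 s : ℕ} (hc : ∀ m, (Sd m).card = s) (r m : ℕ) :
    (Sr Sd B M0 r m).card = s ^ r := by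
  induction r generalizing m with
  | zero => simp [Sr]
  | succ r ih =>
    simp [Sr, Multiset.card_bind, Function.comp_def, ih, hc]
    ring

lemma stage_range {Sd : ℕ → Multiset ℤ} {B M0 : ℕ} (hB : 0 < B)
    (hb : ∀ m, ∀ h ∈ Sd m, h ^ 2 ≤ (B : ℤ) * m) {r m : ℕ} (hm : m ≤ Mr B M0 (r + 1)) {h : ℤ}
    (hh : h ∈ Sd m) : 0 ≤ ((Mr B M0 r / 2 : ℕ) : ℤ) + h ∧
      (((Mr B M0 r / 2 : ℕ) : ℤ) + h).toNat ≤ Mr B M0 r := by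
  set n := Mr B M0 r / 2 with hn
  have h1 : B * m ≤ n ^ 2 := by
    have : m ≤ n ^ 2 / B := hm
    calc B * m ≤ B * (n ^ 2 / B) := Nat.mul_le_mul_left _ this
      _ ≤ n ^ 2 := Nat.mul_div_le _ _
  have h2 : h ^ 2 ≤ (n : ℤ) ^ 2 := (hb m h hh).trans (by exact_mod_cast h1)
  have h3 := abs_le_of_sq_le_sq' h2 (by positivity)
  omega

lemma Sr_mem {Sd : ℕ → Multiset ℤ} {B M0 : ℕ} (hB : 0 < B)
    (hb : ∀ m, ∀ h ∈ Sd m, h ^ 2 ≤ (B : ℤ) * m) (r m : ℕ) (hm : m ≤ Mr B M0 r) :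
    ∀ h ∈ Sr Sd B M0 r m, h ≤ M0 := by
  induction r generalizing m with
  | zero => intro h hh; simp [Sr] at hh; subst hh; exact hm
  | succ r ih =>
    intro h hh
    simp only [Sr, Multiset.mem_bind] at hh
    obtain ⟨u, hu, hh⟩ := hh
    exact ih _ (stage_range hB hb hm hu).2 h hh

lemma Er_natDegree (C : ℕ → ℝ) (B M0 : ℕ) (P : Polynomial ℝ) (r : ℕ) :
    (Er C B M0 P r).natDegree ≤ P.natDegree := by
  induction r with
  | zero => exact le_rfl
  | succ r ih => exact (EE_natDegree _ _ _).trans ((Nat.div_le_self _ _).trans ih)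

lemma Sr_eval {Sd : ℕ → Multiset ℤ} {B M0 K : ℕ} {C : ℕ → ℝ} (hB : 0 < B)
    (hb : ∀ m, ∀ h ∈ Sd m, h ^ 2 ≤ (B : ℤ) * m)
    (hS : ∀ m, ∀ j ≤ K, ((Sd m).map (fun h : ℤ => (h : ℝ) ^ (2 * j))).sum = C j * (m : ℝ) ^ j ∧
        ((Sd m).map (fun h : ℤ => (h : ℝ) ^ (2 * j + 1))).sum = 0)
    (P : Polynomial ℝ) (hP : P.natDegree ≤ K) (r m : ℕ) (hm : m ≤ Mr B M0 r) :
    ((Sr Sd B M0 r m).map (fun h : ℕ => P.eval (h : ℝ))).sum = (Er C B M0 P r).eval (m : ℝ) := by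
  induction r generalizing m with
  | zero => simp [Sr, Er]
  | succ r ih =>
    simp only [Sr, Er]
    rw [Multiset.map_bind, Multiset.sum_bind, ← EE_eval (hS m) _ _ ((Er_natDegree C B M0 P r).trans hP)]
    congr 1
    refine Multiset.map_congr rfl (fun h hh => ?_)
    obtain ⟨h1, h2⟩ := stage_range hB hb hm hh
    rw [ih _ h2]
    congr 1
    have : (((((Mr B M0 r / 2 : ℕ) : ℤ) + h).toNat : ℕ) : ℤ) = ((Mr B M0 r / 2 : ℕ) : ℤ) + h :=
      Int.toNat_of_nonneg h1
    have h3 := congrArg (fun z : ℤ => (z : ℝ)) this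
    simp only [Int.cast_natCast, Int.cast_add] at h3
    exact h3

lemma Mr_upper {B M0 : ℕ} (hB : 0 < B) {q : ℝ} (hq : (M0 : ℝ) ≤ q) (r : ℕ) :
    (Mr B M0 r : ℝ) ≤ q ^ 2 ^ r := by
  induction r with
  | zero => simpa [Mr] using hq
  | succ r ih =>
    have h1 : Mr B M0 (r + 1) ≤ (Mr B M0 r) ^ 2 := by
      calc (Mr B M0 r / 2) ^ 2 / B ≤ (Mr B M0 r / 2) ^ 2 := Nat.div_le_self _ _
        _ ≤ _ := Nat.pow_le_pow_left (Nat.div_le_self _ _) _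
    calc (Mr B M0 (r + 1) : ℝ) ≤ (Mr B M0 r : ℝ) ^ 2 := by exact_mod_cast h1
      _ ≤ (q ^ 2 ^ r) ^ 2 := pow_le_pow_left₀ (Nat.cast_nonneg _) ih _
      _ = q ^ 2 ^ (r + 1) := by rw [← pow_mul, pow_succ 2 r]

lemma half_lower {n : ℕ} (hn : 2 ≤ n) : (n : ℝ) / 3 ≤ ((n / 2 : ℕ) : ℝ) := by
  have : n ≤ 3 * (n / 2) := by omega
  have h2 : (n : ℝ) ≤ 3 * ((n / 2 : ℕ) : ℝ) := by exact_mod_cast this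
  linarith

lemma div_lower {n B : ℕ} (hB : 0 < B) (hn : B ≤ n) : (n : ℝ) / (2 * B) ≤ ((n / B : ℕ) : ℝ) := by
  have h0 := Nat.div_add_mod n B
  have h1 := Nat.mod_lt n hB
  have h2 : 1 ≤ n / B := (Nat.one_le_div_iff hB).2 hn
  have h3 : n ≤ 2 * B * (n / B) := by nlinarith
  have h4 : (n : ℝ) ≤ 2 * B * ((n / B : ℕ) : ℝ) := by exact_mod_cast h3
  rw [div_le_iff₀ (by positivity)]
  linarith

lemma Mr_lower {B : ℕ} (hB : 0 < B) {M0 : ℕ → ℕ} {q : ℕ → ℝ} (hq : Filter.Tendsto q Filter.atTop Filter.atTop)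
    (h0 : ∀ᶠ Z in Filter.atTop, (1 / 2) * q Z ≤ (M0 Z : ℝ)) (r : ℕ) :
    ∃ c : ℝ, 0 < c ∧ ∀ᶠ Z in Filter.atTop, c * q Z ^ 2 ^ r ≤ (Mr B (M0 Z) r : ℝ) := by
  induction r with
  | zero => exact ⟨1 / 2, by norm_num, by simpa [Mr] using h0⟩
  | succ r ih =>
    obtain ⟨c, hc, hev⟩ := ih
    refine ⟨c ^ 2 / (18 * B), by positivity, ?_⟩
    have hB' : (0 : ℝ) < B := by exact_mod_cast hB
    have h1 : Filter.Tendsto (fun Z => c * q Z ^ 2 ^ r) Filter.atTop Filter.atTop :=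
      ((Filter.tendsto_pow_atTop (by positivity)).comp hq).const_mul_atTop hc
    filter_upwards [hev, h1.eventually_ge_atTop (3 * B + 2)] with Z hZ hZ2
    set M := Mr B (M0 Z) r with hM
    have hM1 : (3 * B + 2 : ℝ) ≤ M := hZ2.trans hZ
    have hM2 : 3 * B + 2 ≤ M := by exact_mod_cast hM1
    have h2 := half_lower (n := M) (by omega)
    have h3 : B ≤ M / 2 := by omega
    have h4 := div_lower (n := (M / 2) ^ 2) hB (h3.trans (Nat.le_self_pow (by norm_num) _))
    have h5 : (Mr B (M0 Z) (r + 1) : ℝ) = (((M / 2) ^ 2 / B : ℕ) : ℝ) := rfl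
    rw [h5]
    refine le_trans ?_ h4
    have h6 : (c * q Z ^ 2 ^ r / 3) ≤ ((M / 2 : ℕ) : ℝ) := by linarith
    have h7 : 0 ≤ c * q Z ^ 2 ^ r := by linarith
    have h8 : (c * q Z ^ 2 ^ r / 3) ^ 2 ≤ ((M / 2 : ℕ) : ℝ) ^ 2 := pow_le_pow_left₀ (by positivity) h6 _
    have e : c ^ 2 / (18 * B) * q Z ^ 2 ^ (r + 1) = (c * q Z ^ 2 ^ r / 3) ^ 2 / (2 * B) := by
      rw [pow_succ 2 r, pow_mul]; field_simp; ring
    rw [e]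
    push_cast
    gcongr

lemma Er_Cls {P : Polynomial ℝ} {D R B M0 : ℕ} {S Y U V κ : ℝ} {C : ℕ → ℝ} (h : Cls P D S Y U) (hB : 0 < B)
    (hS : 0 < S) (hU : 1 ≤ U) (hY : 0 < Y) (hV1 : 1 ≤ V)
    (hV : 4 * ((D + 1) * 2 ^ D) * (κ ^ R * U) ^ 2 ≤ V)
    (hM : (M0 : ℝ) ≤ Y / V) (hκ : 1 ≤ κ) (hC : ∀ j ≤ D, 2 / κ ≤ C j ∧ 2 * C j ≤ κ) (r : ℕ) (hr : r ≤ R) :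
    Cls (Er C B M0 P r) (D / 2 ^ r) S (Y ^ 2 ^ r) (κ ^ r * U) := by
  induction r with
  | zero => simpa [Er] using h
  | succ r ih =>
    have ih := ih (by omega)
    have hκr : 1 ≤ κ ^ r := one_le_pow₀ hκ
    have hDle : D / 2 ^ r ≤ D := Nat.div_le_self _ _
    have key := EE_Cls (V := V) (n0 := ((Mr B M0 r / 2 : ℕ) : ℝ)) (κ := κ) (C := C) ih hS (by nlinarith)
      (by positivity) hV1 ?_ (Nat.cast_nonneg _) ?_ (by linarith) (fun j hj => hC j (hj.trans hDle))
    · have e1 : D / 2 ^ r / 2 = D / 2 ^ (r + 1) := by rw [Nat.div_div_eq_div_mul, pow_succ]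
      have e2 : (Y ^ 2 ^ r) ^ 2 = Y ^ 2 ^ (r + 1) := by rw [← pow_mul, pow_succ 2 r]
      have e3 : κ * (κ ^ r * U) = κ ^ (r + 1) * U := by ring
      rw [e1, e2, e3] at key
      exact key
    · refine le_trans ?_ hV
      have h1 : ((D / 2 ^ r : ℕ) : ℝ) ≤ D := by exact_mod_cast hDle
      have h2 : (2 : ℝ) ^ (D / 2 ^ r) ≤ 2 ^ D := pow_le_pow_right₀ (by norm_num) hDle
      have h3 : κ ^ r ≤ κ ^ R := pow_le_pow_right₀ hκ (by omega)
      gcongr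
    · have h1 := Mr_upper hB hM r
      have h2 : ((Mr B M0 r / 2 : ℕ) : ℝ) ≤ (Mr B M0 r : ℝ) := by exact_mod_cast Nat.div_le_self _ _
      refine h2.trans (h1.trans ?_)
      rw [div_pow]
      have : V ≤ V ^ 2 ^ r := le_self_pow₀ hV1 (by positivity)
      gcongr

lemma greedy (R : ℕ) (M m0 : ℕ → ℕ) (Q : ℕ → ℕ → ℝ) (g : ℕ → ℝ)
    (hstep : ∀ i < R, ∀ ρ : ℝ, |ρ| ≤ g i → ∃ m ≤ M i, |Q i m - Q i (m0 i) - ρ| ≤ g (i + 1))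
    (ρ0 : ℝ) (h0 : |ρ0| ≤ g 0) (k : ℕ) (hk : k ≤ R) :
    ∃ m : ℕ → ℕ, (∀ i < k, m i ≤ M i) ∧ |ρ0 - ∑ i ∈ range k, (Q i (m i) - Q i (m0 i))| ≤ g k := by
  induction k with
  | zero => exact ⟨fun _ => 0, by simp, by simpa using h0⟩
  | succ k ih =>
    obtain ⟨m, hm, h⟩ := ih (by omega)
    obtain ⟨m', hm', h'⟩ := hstep k (by omega) _ h
    refine ⟨Function.update m k m', fun i hi => ?_, ?_⟩
    · rcases eq_or_ne i k with rfl | hne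
      · simpa using hm'
      · rw [Function.update_of_ne hne]; exact hm i (by omega)
    · rw [Finset.sum_range_succ, Function.update_self]
      have e : ∑ i ∈ range k, (Q i (Function.update m k m' i) - Q i (m0 i)) =
          ∑ i ∈ range k, (Q i (m i) - Q i (m0 i)) := by
        refine Finset.sum_congr rfl (fun i hi => ?_)
        have : i < k := by simpa using hi
        rw [Function.update_of_ne (by omega)]
      rw [e, ← abs_neg]
      convert h' using 2
      ring

lemma mset_map_finset_sum {ι α : Type*} (s : Finset ι) (f : ι → Multiset α) (g : α → ℝ) :
    ((∑ i ∈ s, f i).map g).sum = ∑ i ∈ s, ((f i).map g).sum := by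
  classical
  induction s using Finset.induction_on with
  | empty => simp
  | insert a s ha ih => rw [Finset.sum_insert ha, Finset.sum_insert ha, Multiset.map_add, Multiset.sum_add, ih]

lemma mset_sum_close {α : Type*} (A : Multiset α) (f g : α → ℝ) (h : ∀ u ∈ A, |f u - g u| ≤ 1) :
    |(A.map f).sum - (A.map g).sum| ≤ A.card := by
  induction A using Multiset.induction_on with
  | empty => simp
  | cons a A ih =>
    have h1 := ih (fun u hu => h u (Multiset.mem_cons_of_mem hu))
    have h2 := h a (Multiset.mem_cons_self a A)
    simp only [Multiset.map_cons, Multiset.sum_cons, Multiset.card_cons]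
    push_cast
    rw [abs_le] at *
    constructor <;> linarith

/-- union of the offsets of all stages -/
def Hs (Sd : ℕ → Multiset ℤ) (B M0 R : ℕ) (m : ℕ → ℕ) : Multiset ℕ :=
  ∑ i ∈ range R, Sr Sd B M0 (i + 1) (m i)

lemma Hs_card {Sd : ℕ → Multiset ℤ} {B M0 s : ℕ} (hc : ∀ m, (Sd m).card = s) (R : ℕ) (m : ℕ → ℕ) :
    (Hs Sd B M0 R m).card = ∑ i ∈ range R, s ^ (i + 1) := by
  rw [Hs, Multiset.card_sum]
  exact Finset.sum_congr rfl (fun i _ => Sr_card hc _ _)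

lemma Hs_mem {Sd : ℕ → Multiset ℤ} {B M0 : ℕ} (hB : 0 < B)
    (hb : ∀ m, ∀ h ∈ Sd m, h ^ 2 ≤ (B : ℤ) * m) (R : ℕ) (m : ℕ → ℕ) (hm : ∀ i < R, m i ≤ Mr B M0 (i + 1)) :
    ∀ h ∈ Hs Sd B M0 R m, h ≤ M0 := by
  intro h hh
  rw [Hs, Multiset.mem_sum] at hh
  obtain ⟨i, hi, hh⟩ := hh
  exact Sr_mem hB hb _ _ (hm i (by simpa using hi)) h hh

lemma stageZ {Sd : ℕ → Multiset ℤ} {B M0 K s R D : ℕ} {C : ℕ → ℝ} (hB : 0 < B)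
    (hc : ∀ m, (Sd m).card = s)
    (hb : ∀ m, ∀ h ∈ Sd m, h ^ 2 ≤ (B : ℤ) * m)
    (hSd : ∀ m, ∀ j ≤ K, ((Sd m).map (fun h : ℤ => (h : ℝ) ^ (2 * j))).sum = C j * (m : ℝ) ^ j ∧
        ((Sd m).map (fun h : ℤ => (h : ℝ) ^ (2 * j + 1))).sum = 0)
    (hDK : D ≤ K) (hRD : 2 ^ R ≤ D)
    {P : Polynomial ℝ} {S Y U V κ : ℝ} (h : Cls P D S Y U)
    (hS : 0 < S) (hU : 1 ≤ U) (hV1 : 1 ≤ V)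
    (hV : 4 * ((D + 1) * 2 ^ D) * (κ ^ R * U) ^ 2 ≤ V) (hYV : 2 * V ≤ Y)
    (hM : (M0 : ℝ) ≤ Y / V) (hκ : 1 ≤ κ) (hC : ∀ j ≤ D, 2 / κ ≤ C j ∧ 2 * C j ≤ κ)
    (g : ℕ → ℝ)
    (hcov : ∀ i < R, g i ≤ ((Mr B M0 (i + 1) / 2 : ℕ) : ℝ) * (S / (2 * (κ ^ (i + 1) * U) * Y ^ 2 ^ (i + 1))))
    (hg : ∀ i < R, 2 * S * (κ ^ (i + 1) * U) / Y ^ 2 ^ (i + 1) ≤ g (i + 1))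
    (a : ℕ → ℝ) (ha : ∀ h ≤ M0, |a h - P.eval (h : ℝ)| ≤ 1) (N : ℝ)
    (hN : |N - ((Hs Sd B M0 R (fun i => Mr B M0 (i + 1) / 2)).map a).sum| +
      ((∑ i ∈ range R, s ^ (i + 1) : ℕ) : ℝ) ≤ g 0) :
    ∃ H : Multiset ℕ, H.card = ∑ i ∈ range R, s ^ (i + 1) ∧ (∀ h ∈ H, h ≤ M0) ∧
      |N - (H.map a).sum| ≤ g R + ((∑ i ∈ range R, s ^ (i + 1) : ℕ) : ℝ) := by
  have hY : 0 < Y := by linarith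
  have hY1 : 1 ≤ Y := by linarith
  have hclose : ∀ m : ℕ → ℕ, (∀ i < R, m i ≤ Mr B M0 (i + 1)) →
      |((Hs Sd B M0 R m).map a).sum - ∑ i ∈ range R, (Er C B M0 P (i + 1)).eval (m i : ℝ)| ≤
        ((∑ i ∈ range R, s ^ (i + 1) : ℕ) : ℝ) := by
    intro m hm
    have h1 : ((Hs Sd B M0 R m).map (fun h : ℕ => P.eval (h : ℝ))).sum =
        ∑ i ∈ range R, (Er C B M0 P (i + 1)).eval (m i : ℝ) := by
      rw [Hs, mset_map_finset_sum]
      refine Finset.sum_congr rfl (fun i hi => ?_)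
      exact Sr_eval hB hb hSd P (h.1.trans hDK) _ _ (hm i (by simpa using hi))
    rw [← h1, ← Hs_card hc R m]
    exact mset_sum_close _ _ _ (fun u hu => ha u (Hs_mem hB hb R m hm u hu))
  have hm0 : ∀ i < R, (fun i => Mr B M0 (i + 1) / 2) i ≤ Mr B M0 (i + 1) := fun i _ => Nat.div_le_self _ _
  have hcl0 := hclose _ hm0
  obtain ⟨m, hm, hfin⟩ := greedy R (fun i => Mr B M0 (i + 1)) (fun i => Mr B M0 (i + 1) / 2)
    (fun i m => (Er C B M0 P (i + 1)).eval (m : ℝ)) g (fun i hi ρ hρ => by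
      have hcl := Er_Cls h hB hS hU hY hV1 hV hM hκ hC (i + 1) (by omega)
      have hDle : D / 2 ^ (i + 1) ≤ D := Nat.div_le_self _ _
      have hκr : 1 ≤ κ ^ (i + 1) := one_le_pow₀ hκ
      have hVV : V ≤ V ^ 2 ^ (i + 1) := le_self_pow₀ hV1 (by positivity)
      have hYY : Y ≤ Y ^ 2 ^ (i + 1) := le_self_pow₀ hY1 (by positivity)
      obtain ⟨m, hm, hh⟩ := cover (V := V) hcl
        (by
          rw [Nat.one_le_div_iff (by positivity)]
          exact (Nat.pow_le_pow_right (by norm_num) (by omega)).trans hRD)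
        hS (by nlinarith) hV1
        (by
          refine le_trans ?_ hV
          have h1 : ((D / 2 ^ (i + 1) : ℕ) : ℝ) ≤ D := by exact_mod_cast hDle
          have h2 : (2 : ℝ) ^ (D / 2 ^ (i + 1)) ≤ 2 ^ D := pow_le_pow_right₀ (by norm_num) hDle
          have h3 : κ ^ (i + 1) ≤ κ ^ R := pow_le_pow_right₀ hκ (by omega)
          gcongr) (by linarith) (Mr B M0 (i + 1))
        (by
          refine (Mr_upper hB hM (i + 1)).trans ?_
          rw [div_pow]
          gcongr) ρ (hρ.trans (hcov i hi))
      exact ⟨m, hm, hh.trans (hg i hi)⟩)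
    (N - ∑ i ∈ range R, (Er C B M0 P (i + 1)).eval ((Mr B M0 (i + 1) / 2 : ℕ) : ℝ))
    (by
      refine le_trans ?_ hN
      set A := ((Hs Sd B M0 R (fun i => Mr B M0 (i + 1) / 2)).map a).sum
      set T := ∑ i ∈ range R, (Er C B M0 P (i + 1)).eval ((Mr B M0 (i + 1) / 2 : ℕ) : ℝ)
      have e : N - T = (N - A) + (A - T) := by ring
      rw [e]
      exact (abs_add_le _ _).trans (add_le_add le_rfl hcl0)) R le_rfl
  refine ⟨Hs Sd B M0 R m, Hs_card hc R m, Hs_mem hB hb R m hm, ?_⟩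
  have hcl := hclose m hm
  rw [Finset.sum_sub_distrib] at hfin
  set A := ((Hs Sd B M0 R m).map a).sum
  set T0 := ∑ i ∈ range R, (Er C B M0 P (i + 1)).eval ((Mr B M0 (i + 1) / 2 : ℕ) : ℝ)
  set T := ∑ i ∈ range R, (Er C B M0 P (i + 1)).eval (m i : ℝ)
  have e : N - A = (N - T0 - (T - T0)) + (T - A) := by ring
  rw [e]
  refine (abs_add_le _ _).trans (add_le_add hfin ?_)
  rwa [abs_sub_comm]

lemma rpow_comparable {Z x e : ℝ} (hZ : 0 < Z) (h1 : Z ≤ x) (h2 : x ≤ 5 * Z) :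
    ((5 : ℝ) ^ |e|)⁻¹ * Z ^ e ≤ x ^ e ∧ x ^ e ≤ (5 : ℝ) ^ |e| * Z ^ e := by
  obtain ⟨y, rfl⟩ : ∃ y, x = y * Z := ⟨x / Z, by field_simp⟩
  have hy1 : 1 ≤ y := by
    by_contra h; push Not at h; nlinarith
  have hy5 : y ≤ 5 := by
    by_contra h; push Not at h; nlinarith
  have hy0 : 0 < y := by linarith
  rw [Real.mul_rpow hy0.le hZ.le]
  have hZe : 0 ≤ Z ^ e := Real.rpow_nonneg hZ.le _
  have h3 : y ^ |e| ≤ 5 ^ |e| := Real.rpow_le_rpow hy0.le hy5 (abs_nonneg _)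
  have h4 : 0 < y ^ |e| := Real.rpow_pos_of_pos hy0 _
  constructor
  · refine mul_le_mul_of_nonneg_right ?_ hZe
    calc ((5 : ℝ) ^ |e|)⁻¹ ≤ (y ^ |e|)⁻¹ := by gcongr
      _ = y ^ (-|e|) := (Real.rpow_neg hy0.le _).symm
      _ ≤ y ^ e := Real.rpow_le_rpow_of_exponent_le hy1 (neg_abs_le e)
  · refine mul_le_mul_of_nonneg_right ?_ hZe
    exact (Real.rpow_le_rpow_of_exponent_le hy1 (le_abs_self e)).trans h3

lemma ev_big (θ : ℝ) (hθ : 0 < θ) (A : ℝ) : ∀ᶠ Z : ℕ in Filter.atTop, A ≤ (Z : ℝ) ^ θ :=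
  ((tendsto_rpow_atTop hθ).comp tendsto_natCast_atTop_atTop).eventually_ge_atTop A

lemma DegFam.size {c x0 : ℝ} {F : ℕ → ℝ → ℝ} (h : DegFam c x0 F) (j : ℕ) :
    ∀ᶠ Z : ℕ in Filter.atTop, ∀ x : ℝ, (Z : ℝ) ≤ x → x ≤ 5 * Z →
      (Z : ℝ) ^ c / ((Z : ℝ) ^ (1 / 32 : ℝ) * (Z : ℝ) ^ j) ≤ |F j x / (j.factorial : ℝ)| ∧
        |F j x| ≤ (Z : ℝ) ^ c * (Z : ℝ) ^ (1 / 32 : ℝ) / (Z : ℝ) ^ j := by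
  obtain ⟨A, B, x1, hA, hB, hbd⟩ := h.bd (1 / 64) (by norm_num) j
  have hfac : (0 : ℝ) < j.factorial := by exact_mod_cast j.factorial_pos
  set e1 := c - j - 1 / 64 with he1
  set e2 := c - j + 1 / 64 with he2
  have h51 : (0 : ℝ) < 5 ^ |e1| := by positivity
  have h52 : (0 : ℝ) < 5 ^ |e2| := by positivity
  filter_upwards [ev_big (1 / 64) (by norm_num) (j.factorial * 5 ^ |e1| / A),
    ev_big (1 / 64) (by norm_num) (B * 5 ^ |e2|), Filter.eventually_ge_atTop 1,
    tendsto_natCast_atTop_atTop.eventually_ge_atTop x1] with Z hZ1 hZ2 hZ3 hZ4 x hx1 hx2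
  have hZ0 : (0 : ℝ) < Z := by exact_mod_cast hZ3
  obtain ⟨b1, b2⟩ := hbd x (hZ4.trans hx1)
  obtain ⟨c1, -⟩ := rpow_comparable (e := e1) hZ0 hx1 hx2
  obtain ⟨-, c2⟩ := rpow_comparable (e := e2) hZ0 hx1 hx2
  set v := (Z : ℝ) ^ (1 / 64 : ℝ) with hv
  have hv0 : 0 < v := Real.rpow_pos_of_pos hZ0 _
  have hw : (Z : ℝ) ^ (1 / 32 : ℝ) = v * v := by
    rw [hv, ← Real.rpow_add hZ0]; norm_num
  have hS0 : 0 < (Z : ℝ) ^ c := Real.rpow_pos_of_pos hZ0 _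
  have hj0 : 0 < (Z : ℝ) ^ j := by positivity
  have E1 : (Z : ℝ) ^ e1 = (Z : ℝ) ^ c / ((Z : ℝ) ^ j * v) := by
    rw [he1, Real.rpow_sub hZ0, Real.rpow_sub hZ0, Real.rpow_natCast, div_div]
  have E2 : (Z : ℝ) ^ e2 = (Z : ℝ) ^ c * v / (Z : ℝ) ^ j := by
    rw [he2, Real.rpow_add hZ0, Real.rpow_sub hZ0, Real.rpow_natCast]; ring
  rw [E1] at c1
  rw [E2] at c2
  rw [hw]
  constructor
  · rw [abs_div, abs_of_pos hfac, le_div_iff₀ hfac]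
    refine le_trans ?_ b1
    refine le_trans ?_ (mul_le_mul_of_nonneg_left c1 hA.le)
    rw [div_le_iff₀ hA] at hZ1
    have e : A * ((5 ^ |e1|)⁻¹ * ((Z : ℝ) ^ c / ((Z : ℝ) ^ j * v))) =
      (v * A / 5 ^ |e1|) * ((Z : ℝ) ^ c / (v * v * (Z : ℝ) ^ j)) := by field_simp
    rw [e, mul_comm]
    refine mul_le_mul_of_nonneg_right ?_ (by positivity)
    rw [le_div_iff₀ h51]
    exact hZ1
  · refine b2.trans ((mul_le_mul_of_nonneg_left c2 hB.le).trans ?_)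
    have e : B * (5 ^ |e2| * ((Z : ℝ) ^ c * v / (Z : ℝ) ^ j)) =
      (B * 5 ^ |e2|) * ((Z : ℝ) ^ c * v / (Z : ℝ) ^ j) := by ring
    rw [e]
    refine (mul_le_mul_of_nonneg_right hZ2 (by positivity)).trans (le_of_eq ?_)
    ring

lemma taylor_bd (n : ℕ) : ∀ (G : ℕ → ℝ → ℝ) (X H Bd : ℝ),
    (∀ i x, X ≤ x → HasDerivAt (G i) (G (i + 1) x) x) →
    (∀ x, X ≤ x → x ≤ X + H → |G n x| ≤ Bd) → ∀ t, 0 ≤ t → t ≤ H →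
    |G 0 (X + t) - ∑ j ∈ range n, G j X / (j.factorial : ℝ) * t ^ j| ≤ Bd * t ^ n := by
  induction n with
  | zero => intro G X H Bd hG hb t h0 h1; simpa using hb (X + t) (by linarith) (by linarith)
  | succ n ih =>
    intro G X H Bd hG hb t h0 h1
    set φ : ℝ → ℝ := fun u => G 0 (X + u) - ∑ j ∈ range (n + 1), G j X / (j.factorial : ℝ) * u ^ j with hφ
    set φ' : ℝ → ℝ := fun u => G 1 (X + u) - ∑ j ∈ range n, G (j + 1) X / (j.factorial : ℝ) * u ^ j with hφ'
    have hBd : 0 ≤ Bd := (abs_nonneg _).trans (hb X le_rfl (by linarith))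
    have hder : ∀ u ∈ Set.Icc 0 t, HasDerivWithinAt φ (φ' u) (Set.Icc 0 t) u := by
      intro u hu
      refine HasDerivAt.hasDerivWithinAt ?_
      have d1 : HasDerivAt (fun u => G 0 (X + u)) (G 1 (X + u)) u := by
        have := (hG 0 (X + u) (by linarith [hu.1])).comp_const_add X u
        simpa using this
      have d2 : HasDerivAt (fun u : ℝ => ∑ j ∈ range (n + 1), G j X / (j.factorial : ℝ) * u ^ j)
          (∑ j ∈ range n, G (j + 1) X / (j.factorial : ℝ) * u ^ j) u := by
        have : HasDerivAt (fun u : ℝ => ∑ j ∈ range (n + 1), G j X / (j.factorial : ℝ) * u ^ j)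
          (∑ j ∈ range (n + 1), G j X / (j.factorial : ℝ) * ((j : ℝ) * u ^ (j - 1))) u := by
          refine HasDerivAt.fun_sum (fun j _ => ?_)
          exact (hasDerivAt_pow j u).const_mul _
        rw [Finset.sum_range_succ'] at this
        convert this using 1
        simp only [Nat.cast_zero, zero_mul, mul_zero, add_zero]
        refine Finset.sum_congr rfl (fun j _ => ?_)
        rw [Nat.factorial_succ]
        push_cast
        have : (0 : ℝ) < j.factorial := by exact_mod_cast j.factorial_pos
        field_simp
      exact d1.sub d2
    have hbound : ∀ u ∈ Set.Icc 0 t, ‖φ' u‖ ≤ Bd * t ^ n := by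
      intro u hu
      have := ih (fun i => G (i + 1)) X H Bd (fun i x hx => hG (i + 1) x hx) hb u hu.1 (by linarith [hu.2])
      rw [Real.norm_eq_abs]
      refine this.trans ?_
      exact mul_le_mul_of_nonneg_left (pow_le_pow_left₀ hu.1 hu.2 _) hBd
    have key := (convex_Icc (0 : ℝ) t).norm_image_sub_le_of_norm_hasDerivWithin_le hder hbound
      (Set.left_mem_Icc.2 h0) (Set.right_mem_Icc.2 h0)
    have h00 : φ 0 = 0 := by
      simp only [hφ]
      rw [Finset.sum_range_succ']
      simp
    rw [h00, sub_zero, sub_zero, Real.norm_eq_abs, Real.norm_eq_abs, abs_of_nonneg h0] at key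
    calc _ = |φ t| := rfl
      _ ≤ _ := key
      _ = Bd * t ^ (n + 1) := by ring

lemma mset_close_gen (A : Multiset ℕ) (f g : ℕ → ℝ) (δ : ℝ) (h : ∀ u ∈ A, |f u - g u| ≤ δ) :
    |(A.map f).sum - (A.map g).sum| ≤ A.card * δ := by
  induction A using Multiset.induction_on with
  | empty => simp
  | cons a A ih =>
    have h1 := h a (Multiset.mem_cons_self _ _)
    have h2 := ih (fun u hu => h u (Multiset.mem_cons_of_mem hu))
    simp only [Multiset.map_cons, Multiset.sum_cons, Multiset.card_cons]
    push_cast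
    rw [abs_le] at *
    constructor <;> linarith [h1.1, h1.2, h2.1, h2.2]

lemma mset_sum_mono (A : Multiset ℕ) (f : ℕ → ℝ) (b b2 : ℝ) (h : ∀ u ∈ A, b ≤ f u ∧ f u ≤ b2) :
    A.card * b ≤ (A.map f).sum ∧ (A.map f).sum ≤ A.card * b2 := by
  induction A using Multiset.induction_on with
  | empty => simp
  | cons a A ih =>
    have h1 := h a (Multiset.mem_cons_self _ _)
    have h2 := ih (fun u hu => h u (Multiset.mem_cons_of_mem hu))
    simp only [Multiset.map_cons, Multiset.sum_cons, Multiset.card_cons]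
    push_cast
    constructor <;> linarith [h1.1, h1.2, h2.1, h2.2]

/-- For all large scales `Z` the window `[Z, 5Z]` covers every target up to a bounded error. -/
lemma syndetic_Z {c x0 : ℝ} (hc : 1 ≤ c) {F : ℕ → ℝ → ℝ} (h : DegFam c x0 F)
    (hmono : ∃ x2, ∀ x, x2 ≤ x → 0 < F 1 x) :
    ∃ (s : ℕ) (G : ℝ), 0 < s ∧ ∀ᶠ Z : ℕ in Filter.atTop, ∀ N : ℝ, s * F 0 (2 * (Z : ℝ)) ≤ N →
      N ≤ s * F 0 (2 * (Z : ℝ) + 2) →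
      ∃ A : Multiset ℕ, A.card = s ∧ (∀ n ∈ A, Z ≤ n) ∧ |N - (A.map (fun n : ℕ => F 0 (n : ℝ))).sum| ≤ G := by
  obtain ⟨R, hR⟩ : ∃ R : ℕ, c + 1 ≤ 2 ^ R := by
    obtain ⟨R, hR⟩ := pow_unbounded_of_one_lt (c + 1) (by norm_num : (1 : ℝ) < 2)
    exact ⟨R, hR.le⟩
  have hR0 : 0 < R := by
    rcases Nat.eq_zero_or_pos R with rfl | hp
    · norm_num at hR; linarith
    · exact hp
  obtain ⟨D, hD⟩ : ∃ D : ℕ, D = 8 * 2 ^ R := ⟨_, rfl⟩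
  obtain ⟨s, B, C, hs, hB, hC, hdes⟩ := design4 D
  choose Sd hcard hb hmom using hdes
  obtain ⟨κ, hκ1, hκ⟩ : ∃ κ : ℝ, 1 ≤ κ ∧ ∀ j ≤ D, 2 / κ ≤ C j ∧ 2 * C j ≤ κ := by
    refine ⟨1 + ∑ j ∈ range (D + 1), (2 * C j + 2 / C j), ?_, fun j hj => ?_⟩
    · have : 0 ≤ ∑ j ∈ range (D + 1), (2 * C j + 2 / C j) :=
        Finset.sum_nonneg (fun j _ => by have := hC j; positivity)
      linarith
    · have h1 : 2 * C j + 2 / C j ≤ ∑ j ∈ range (D + 1), (2 * C j + 2 / C j) :=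
        Finset.single_le_sum (f := fun j => 2 * C j + 2 / C j)
          (fun j _ => by have := hC j; positivity) (by simp; omega)
      set T := ∑ j ∈ range (D + 1), (2 * C j + 2 / C j)
      have h2 := hC j
      have h3 : 0 < 2 / C j := by positivity
      constructor
      · rw [div_le_iff₀ (by linarith)]
        have : 2 / C j ≤ 1 + T := by linarith
        rw [div_le_iff₀ h2] at this
        linarith
      · linarith
  set st : ℕ := ∑ i ∈ range R, s ^ (i + 1) with hst
  have hst0 : 0 < st := Finset.sum_pos (fun i _ => by positivity) ⟨0, by simpa using hR0⟩
  set Λ : ℝ := 2 * κ ^ R + 2 * st with hΛ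
  have hκR : 1 ≤ κ ^ R := one_le_pow₀ hκ1
  have hΛ0 : 0 < Λ := by positivity
  set w : ℕ → ℝ := fun Z => (Z : ℝ) ^ (1 / 32 : ℝ) with hw
  have hwtop : Filter.Tendsto w Filter.atTop Filter.atTop :=
    (tendsto_rpow_atTop (by norm_num)).comp tendsto_natCast_atTop_atTop
  have hw32 : ∀ Z : ℕ, w Z ^ 32 = (Z : ℝ) := by
    intro Z
    rw [hw, ← Real.rpow_natCast, ← Real.rpow_mul (Nat.cast_nonneg _)]
    norm_num
  set M0 : ℕ → ℕ := fun Z => ⌊w Z ^ 28⌋₊ with hM0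
  have hqtop : Filter.Tendsto (fun Z => w Z ^ 28) Filter.atTop Filter.atTop :=
    (Filter.tendsto_pow_atTop (by norm_num)).comp hwtop
  have hM0l : ∀ᶠ Z in Filter.atTop, (1 / 2) * w Z ^ 28 ≤ (M0 Z : ℝ) := by
    filter_upwards [hqtop.eventually_ge_atTop 2] with Z hZ
    have := Nat.lt_floor_add_one (w Z ^ 28)
    simp only [hM0]
    linarith
  have hMr := fun r => Mr_lower hB hqtop hM0l r
  choose cr hcr0 hcr using hMr
  obtain ⟨x2, hx2⟩ := hmono
  have hsize : ∀ᶠ Z : ℕ in Filter.atTop, ∀ j ∈ range (D + 2), ∀ x : ℝ, (Z : ℝ) ≤ x → x ≤ 5 * Z →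
      (Z : ℝ) ^ c / ((Z : ℝ) ^ (1 / 32 : ℝ) * (Z : ℝ) ^ j) ≤ |F j x / (j.factorial : ℝ)| ∧
        |F j x| ≤ (Z : ℝ) ^ c * (Z : ℝ) ^ (1 / 32 : ℝ) / (Z : ℝ) ^ j :=
    (Filter.eventually_all_finset _).2 (fun j _ => h.size j)
  have hcrev : ∀ᶠ Z : ℕ in Filter.atTop, ∀ i ∈ range R,
      cr (i + 1) * (w Z ^ 28) ^ 2 ^ (i + 1) ≤ (Mr B (M0 Z) (i + 1) : ℝ) ∧
      6 * κ ^ (i + 1) * Λ ≤ cr (i + 1) * w Z ∧ 2 ≤ cr (i + 1) * w Z := by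
    refine (Filter.eventually_all_finset _).2 (fun i _ => ?_)
    have h1 := hwtop.const_mul_atTop (hcr0 (i + 1))
    filter_upwards [hcr (i + 1), h1.eventually_ge_atTop (6 * κ ^ (i + 1) * Λ),
      h1.eventually_ge_atTop 2] with Z a b c
    exact ⟨a, b, c⟩
  refine ⟨st, Λ + st, hst0, ?_⟩
  filter_upwards [hsize, hcrev, hwtop.eventually_ge_atTop 2,
    hwtop.eventually_ge_atTop (4 * ((D + 1) * 2 ^ D) * (κ ^ R) ^ 2),
    tendsto_natCast_atTop_atTop.eventually_ge_atTop x2,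
    tendsto_natCast_atTop_atTop.eventually_gt_atTop x0, Filter.eventually_ge_atTop 3]
    with Z hsz hcv hw2 hwV hZx2 hZx0 hZ3 N hN1 hN2
  have hZ0 : (0 : ℝ) < Z := by exact_mod_cast (by omega : 0 < Z)
  have hZ3' : (3 : ℝ) ≤ Z := by exact_mod_cast hZ3
  set v := w Z with hv
  have hwe : (Z : ℝ) ^ (1 / 32 : ℝ) = v := rfl
  have hv0 : 0 < v := by linarith
  have hv1 : 1 ≤ v := by linarith
  have hvZ : v ^ 32 = (Z : ℝ) := hw32 Z
  set S : ℝ := (Z : ℝ) ^ c with hS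
  have hS0 : 0 < S := Real.rpow_pos_of_pos hZ0 _
  have hSZ : (Z : ℝ) ≤ S := by
    calc (Z : ℝ) = (Z : ℝ) ^ (1 : ℝ) := (Real.rpow_one _).symm
      _ ≤ S := Real.rpow_le_rpow_of_exponent_le (by linarith) hc
  have hSv : S * v ≤ (Z : ℝ) ^ 2 ^ R := by
    rw [← hwe, hS, ← Real.rpow_add hZ0, ← Real.rpow_natCast]
    refine Real.rpow_le_rpow_of_exponent_le (by linarith) ?_
    push_cast; linarith
  have hSv1 : 1 ≤ S * v / Z := by
    rw [le_div_iff₀ hZ0]; nlinarith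
  set M := M0 Z with hM
  have hMv : (M : ℝ) ≤ v ^ 28 := Nat.floor_le (by positivity)
  have hMZ : (M : ℝ) ≤ Z := by
    rw [← hvZ]; exact hMv.trans (pow_le_pow_right₀ hv1 (by norm_num))
  have hMZ' : M ≤ Z := by exact_mod_cast hMZ
  have hFm : MonotoneOn (F 0) (Set.Ici (Z : ℝ)) := by
    refine monotoneOn_of_deriv_nonneg (convex_Ici _) ?_ ?_ ?_
    · intro x hx
      exact (h.der 0 x (lt_of_lt_of_le hZx0 hx)).continuousAt.continuousWithinAt
    · intro x hx
      rw [interior_Ici] at hx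
      exact (h.der 0 x (hZx0.trans hx)).differentiableAt.differentiableWithinAt
    · intro x hx
      rw [interior_Ici] at hx
      rw [(h.der 0 x (hZx0.trans hx)).deriv]
      exact (hx2 x (hZx2.trans (le_of_lt hx))).le
  -- step 1: choose the centre
  set H0 := Hs Sd B M R (fun i => Mr B M (i + 1) / 2) with hH0
  have hH0c : H0.card = st := Hs_card hcard R _
  have hH0m : ∀ u ∈ H0, u ≤ M := Hs_mem hB hb R _ (fun i _ => Nat.div_le_self _ _)
  have hD2 : 1 < D + 2 := by omega
  have hstep1 : ∀ x : ℝ, (Z : ℝ) ≤ x → x + 1 ≤ 5 * Z → |F 0 (x + 1) - F 0 x| ≤ S * v / Z := by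
    intro x hx1 hx2
    have := taylor_bd 1 F x 1 (S * v / Z)
      (fun i y hy => h.der i y (by linarith))
      (fun y hy1 hy2 => by
        have := (hsz 1 (by simp) y (by linarith) (by linarith)).2
        rw [hwe, pow_one] at this
        exact this) 1 (by norm_num) le_rfl
    simp only [Finset.sum_range_one, Nat.factorial_zero, Nat.cast_one, div_one, pow_zero, mul_one,
      one_pow] at this
    exact this
  obtain ⟨m, hmle, hmN⟩ := discrete_ivt
    (fun m : ℕ => (H0.map (fun u : ℕ => F 0 ((Z : ℝ) + m + u))).sum) (st * (S * v / Z))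
    (mul_nonneg (Nat.cast_nonneg _) (by linarith)) (Z + 2)
    (by
      intro m hm
      have := mset_close_gen H0 (fun u : ℕ => F 0 ((Z : ℝ) + (m + 1 : ℕ) + u))
        (fun u : ℕ => F 0 ((Z : ℝ) + m + u)) (S * v / Z) (by
          intro u hu
          have hu1 : (u : ℝ) ≤ Z := by exact_mod_cast (hH0m u hu).trans hMZ'
          have hm1 : (m : ℝ) + 1 ≤ Z + 2 := by exact_mod_cast (by omega : m + 1 ≤ Z + 2)
          have hu0 : (0 : ℝ) ≤ u := Nat.cast_nonneg _
          have hm0 : (0 : ℝ) ≤ m := Nat.cast_nonneg _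
          have h3 := hstep1 ((Z : ℝ) + m + u) (by linarith) (by linarith)
          have e : (Z : ℝ) + (m + 1 : ℕ) + u = (Z : ℝ) + m + u + 1 := by push_cast; ring
          rw [e]; exact h3)
      rw [hH0c] at this
      exact this) N
    (by
      left
      constructor
      · have := (mset_sum_mono H0 (fun u : ℕ => F 0 ((Z : ℝ) + (0 : ℕ) + u)) (F 0 Z) (F 0 (2 * Z)) (by
          intro u hu
          have hu1 : (u : ℝ) ≤ Z := by exact_mod_cast (hH0m u hu).trans hMZ'
          have hu0 : (0 : ℝ) ≤ u := Nat.cast_nonneg _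
          push_cast
          constructor
          · exact hFm (by simp) (by simp) (by linarith)
          · exact hFm (by simp) (by simp; linarith) (by linarith))).2
        rw [hH0c] at this
        exact this.trans hN1
      · have := (mset_sum_mono H0 (fun u : ℕ => F 0 ((Z : ℝ) + (Z + 2 : ℕ) + u)) (F 0 (2 * Z + 2))
          (F 0 (3 * Z + 2)) (by
          intro u hu
          have hu1 : (u : ℝ) ≤ Z := by exact_mod_cast (hH0m u hu).trans hMZ'
          have hu0 : (0 : ℝ) ≤ u := Nat.cast_nonneg _
          push_cast
          constructor
          · exact hFm (by simp; linarith) (by simp; linarith) (by linarith)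
          · exact hFm (by simp; linarith) (by simp; linarith) (by linarith))).1
        rw [hH0c] at this
        exact hN2.trans this)
  have hm1 : (m : ℝ) ≤ Z + 2 := by exact_mod_cast hmle
  have hm0 : (0 : ℝ) ≤ m := Nat.cast_nonneg _
  set X : ℝ := (Z : ℝ) + m with hX
  have hXZ : (Z : ℝ) ≤ X := by linarith
  have hX4 : X + Z ≤ 5 * Z := by linarith
  -- step 2: the Taylor polynomial
  set P : Polynomial ℝ := ∑ j ∈ range (D + 1), Polynomial.monomial j (F j X / (j.factorial : ℝ)) with hP
  have hPc : ∀ k ≤ D, P.coeff k = F k X / (k.factorial : ℝ) := by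
    intro k hk
    rw [hP, Polynomial.finsetSum_coeff]
    simp only [Polynomial.coeff_monomial]
    rw [Finset.sum_ite_eq']
    simp [Nat.lt_succ_of_le hk]
  have hPd : P.natDegree ≤ D := by
    refine Polynomial.natDegree_sum_le_of_forall_le _ _ (fun j hj => ?_)
    refine (Polynomial.natDegree_monomial_le _).trans ?_
    simp at hj; omega
  have hcls : Cls P D S Z v := by
    refine ⟨hPd, fun j hj1 hj2 => ?_⟩
    rw [hPc j hj2]
    obtain ⟨h1, h2⟩ := hsz j (by simp; omega) X hXZ (by linarith)
    rw [hwe] at h1 h2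
    refine ⟨h1, le_trans ?_ h2⟩
    rw [abs_div, Nat.abs_cast]
    exact div_le_self (abs_nonneg _) (by exact_mod_cast Nat.one_le_iff_ne_zero.2 (Nat.factorial_ne_zero j))
  have hPe : ∀ t : ℝ, P.eval t = ∑ j ∈ range (D + 1), F j X / (j.factorial : ℝ) * t ^ j := by
    intro t
    rw [hP, Polynomial.eval_finsetSum]
    simp only [Polynomial.eval_monomial]
  have h2R : (Z : ℝ) ^ 2 ^ R = v ^ (4 * D) := by
    rw [← hvZ, ← pow_mul, hD]; congr 1; ring
  have ha : ∀ u ≤ M, |(fun u : ℕ => F 0 (X + u)) u - P.eval (u : ℝ)| ≤ 1 := by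
    intro u hu
    have hu1 : (u : ℝ) ≤ M := by exact_mod_cast hu
    have hu0 : (0 : ℝ) ≤ u := Nat.cast_nonneg _
    have := taylor_bd (D + 1) F X Z (S * v / (Z : ℝ) ^ (D + 1))
      (fun i y hy => h.der i y (by linarith))
      (fun y hy1 hy2 => by
        have := (hsz (D + 1) (by simp) y (by linarith) (by linarith)).2
        rw [hwe] at this
        exact this) u hu0 (by linarith)
    rw [hPe]
    refine this.trans ?_
    rw [div_mul_eq_mul_div, div_le_one (by positivity)]
    calc S * v * (u : ℝ) ^ (D + 1) ≤ v ^ (4 * D) * (v ^ 28) ^ (D + 1) := by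
          rw [← h2R]; gcongr; linarith
      _ ≤ v ^ (4 * (D + 1)) * (v ^ 28) ^ (D + 1) := by
          gcongr
          omega
      _ = (v ^ 32) ^ (D + 1) := by ring
      _ = _ := by rw [hvZ]
  -- step 3: apply the stage lemma
  have hpow2 : ∀ i : ℕ, (Z : ℝ) ^ 2 ^ (i + 1) = ((Z : ℝ) ^ 2 ^ i) ^ 2 := fun i => by
    rw [← pow_mul]; congr 1
  have hSvnn : 0 ≤ S * v := by positivity
  have hcov : ∀ i < R, (fun i => Λ * (S * v) / (Z : ℝ) ^ 2 ^ i) i ≤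
      ((Mr B M (i + 1) / 2 : ℕ) : ℝ) * (S / (2 * (κ ^ (i + 1) * v) * (Z : ℝ) ^ 2 ^ (i + 1))) := by
    intro i hi
    obtain ⟨c1, c2, c3⟩ := hcv i (by simpa using hi)
    have hq : v ≤ (v ^ 28) ^ 2 ^ (i + 1) := by
      rw [← pow_mul]
      exact le_self_pow₀ hv1 (by positivity)
    have hM2 : 2 ≤ Mr B M (i + 1) := by
      have : (2 : ℝ) ≤ (Mr B M (i + 1) : ℝ) := by
        refine le_trans (c3.trans ?_) c1
        exact mul_le_mul_of_nonneg_left hq (hcr0 _).le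
      exact_mod_cast this
    have hhl := half_lower hM2
    have hκi : 0 < κ ^ (i + 1) := by positivity
    have key : Λ * (S * v) / (Z : ℝ) ^ 2 ^ i ≤ (cr (i + 1) * (v ^ 28) ^ 2 ^ (i + 1) / 3) *
        (S / (2 * (κ ^ (i + 1) * v) * (Z : ℝ) ^ 2 ^ (i + 1))) := by
      rw [div_mul_div_comm, div_le_div_iff₀ (by positivity) (by positivity), hpow2]
      set y := (Z : ℝ) ^ 2 ^ i with hy
      have hy0 : 0 < y := by positivity
      have hyv : y = v ^ (32 * 2 ^ i) := by rw [hy, ← hvZ, ← pow_mul]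
      have hk : v ^ 3 * y ≤ (v ^ 28) ^ 2 ^ (i + 1) := by
        rw [hyv, ← pow_add, ← pow_mul]
        refine pow_le_pow_right₀ hv1 ?_
        have : 1 ≤ 2 ^ i := Nat.one_le_two_pow
        rw [pow_succ]; omega
      calc Λ * (S * v) * (3 * (2 * (κ ^ (i + 1) * v) * y ^ 2))
          = (6 * κ ^ (i + 1) * Λ) * (S * v ^ 2 * y ^ 2) := by ring
        _ ≤ (cr (i + 1) * v) * (S * v ^ 2 * y ^ 2) := by gcongr
        _ = cr (i + 1) * (v ^ 3 * y) * S * y := by ring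
        _ ≤ cr (i + 1) * ((v ^ 28) ^ 2 ^ (i + 1)) * S * y := by
            have := (hcr0 (i + 1)).le
            gcongr
        _ = _ := by ring
    refine key.trans ?_
    gcongr
    linarith
  have hgg : ∀ i < R, 2 * S * (κ ^ (i + 1) * v) / (Z : ℝ) ^ 2 ^ (i + 1) ≤
      (fun i => Λ * (S * v) / (Z : ℝ) ^ 2 ^ i) (i + 1) := by
    intro i hi
    have h1 : κ ^ (i + 1) ≤ κ ^ R := pow_le_pow_right₀ hκ1 (by omega)
    have h2 : 2 * κ ^ (i + 1) ≤ Λ := by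
      have : (0 : ℝ) ≤ st := Nat.cast_nonneg _
      rw [hΛ]; linarith
    show _ ≤ Λ * (S * v) / (Z : ℝ) ^ 2 ^ (i + 1)
    gcongr ?_ / _
    calc 2 * S * (κ ^ (i + 1) * v) = (2 * κ ^ (i + 1)) * (S * v) := by ring
      _ ≤ Λ * (S * v) := by gcongr
  have hVv : 4 * (((D : ℝ) + 1) * 2 ^ D) * (κ ^ R * v) ^ 2 ≤ v ^ 4 := by
    calc 4 * (((D : ℝ) + 1) * 2 ^ D) * (κ ^ R * v) ^ 2
        = (4 * (((D : ℝ) + 1) * 2 ^ D) * (κ ^ R) ^ 2) * v ^ 2 := by ring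
      _ ≤ v * v ^ 2 := by gcongr
      _ = v ^ 3 := by ring
      _ ≤ v ^ 4 := pow_le_pow_right₀ hv1 (by norm_num)
  have hYV : 2 * v ^ 4 ≤ (Z : ℝ) := by
    rw [← hvZ]
    calc 2 * v ^ 4 ≤ v * v ^ 4 := by gcongr
      _ = v ^ 5 := by ring
      _ ≤ v ^ 32 := pow_le_pow_right₀ hv1 (by norm_num)
  have hMY : (M : ℝ) ≤ Z / v ^ 4 := by
    rw [le_div_iff₀ (by positivity), ← hvZ]
    calc (M : ℝ) * v ^ 4 ≤ v ^ 28 * v ^ 4 := by gcongr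
      _ = v ^ 32 := by ring
  have hNN : |N - (H0.map (fun u : ℕ => F 0 (X + u))).sum| + ((∑ i ∈ range R, s ^ (i + 1) : ℕ) : ℝ) ≤
      (fun i => Λ * (S * v) / (Z : ℝ) ^ 2 ^ i) 0 := by
    rw [abs_sub_comm]
    show _ ≤ Λ * (S * v) / (Z : ℝ) ^ 2 ^ 0
    rw [pow_zero, pow_one, mul_div_assoc]
    have h1 : (st : ℝ) ≤ st * (S * v / Z) := le_mul_of_one_le_right (Nat.cast_nonneg _) hSv1
    have h2 : (2 * (st : ℝ)) * (S * v / Z) ≤ Λ * (S * v / Z) := by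
      gcongr; rw [hΛ]; linarith
    have h3 : |(H0.map (fun u : ℕ => F 0 (X + u))).sum - N| ≤ st * (S * v / Z) := hmN
    have h4 : ((∑ i ∈ range R, s ^ (i + 1) : ℕ) : ℝ) = st := rfl
    rw [h4]
    linarith
  have hDR : 2 ^ R ≤ D := by omega
  obtain ⟨H, hHc, hHm, hHN⟩ := stageZ hB hcard hb hmom le_rfl hDR hcls hS0 hv1 (one_le_pow₀ hv1)
    hVv hYV hMY hκ1 hκ (fun i => Λ * (S * v) / (Z : ℝ) ^ 2 ^ i) hcov hgg
    (fun u : ℕ => F 0 (X + u)) ha N hNN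
  refine ⟨H.map (fun u => Z + m + u), by rw [Multiset.card_map]; exact hHc, ?_, ?_⟩
  · intro n hn
    obtain ⟨u, _, rfl⟩ := Multiset.mem_map.1 hn
    omega
  · rw [Multiset.map_map]
    have e : ((fun n : ℕ => F 0 (n : ℝ)) ∘ fun u => Z + m + u) = fun u : ℕ => F 0 (X + u) := by
      funext u
      show F 0 ((Z + m + u : ℕ) : ℝ) = F 0 (X + u)
      rw [hX, Nat.cast_add, Nat.cast_add]
    rw [e]
    refine hHN.trans ?_
    have : Λ * (S * v) / (Z : ℝ) ^ 2 ^ R ≤ Λ := by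
      rw [div_le_iff₀ (pow_pos hZ0 _)]
      exact mul_le_mul_of_nonneg_left hSv hΛ0.le
    have h4 : ((∑ i ∈ range R, s ^ (i + 1) : ℕ) : ℝ) = st := rfl
    rw [h4]
    linarith

/-- Every large real target is within `G` of a sum of `s` values of `F 0`. -/
lemma syndetic_all {c x0 : ℝ} (hc : 1 ≤ c) {F : ℕ → ℝ → ℝ} (h : DegFam c x0 F)
    (hmono : ∃ x2, ∀ x, x2 ≤ x → 0 < F 1 x) (htop : Filter.Tendsto (F 0) Filter.atTop Filter.atTop)
    (n1 : ℕ) :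
    ∃ (s : ℕ) (G N0 : ℝ), ∀ N : ℝ, N0 ≤ N →
      ∃ A : Multiset ℕ, A.card = s ∧ (∀ n ∈ A, n1 ≤ n) ∧
        |N - (A.map (fun n : ℕ => F 0 (n : ℝ))).sum| ≤ G := by
  obtain ⟨s, G, hs, hev⟩ := syndetic_Z hc h hmono
  obtain ⟨Z1, hZ1⟩ := Filter.eventually_atTop.1 hev
  set Z0 := max Z1 n1 with hZ0
  refine ⟨s, G, s * F 0 (2 * (Z0 : ℝ)), fun N hN => ?_⟩
  have hs' : (0 : ℝ) < s := by exact_mod_cast hs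
  have hex : ∃ k : ℕ, N < s * F 0 (2 * ((Z0 + k : ℕ) : ℝ)) := by
    have h1 : Filter.Tendsto (fun k : ℕ => 2 * ((Z0 + k : ℕ) : ℝ)) Filter.atTop Filter.atTop := by
      refine Filter.Tendsto.const_mul_atTop (by norm_num) ?_
      refine tendsto_natCast_atTop_atTop.comp ?_
      exact Filter.tendsto_atTop_mono (fun k => Nat.le_add_left k Z0) Filter.tendsto_id
    have h2 := ((htop.comp h1).const_mul_atTop hs').eventually_gt_atTop N
    obtain ⟨k, hk⟩ := h2.exists
    exact ⟨k, hk⟩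
  classical
  have hk1 := Nat.find_spec hex
  have hk2 := fun m => Nat.find_min hex (m := m)
  set k := Nat.find hex with hk
  obtain ⟨l, hl⟩ : ∃ l, k = l + 1 := by
    rcases Nat.eq_zero_or_pos k with h0 | hp
    · rw [h0] at hk1; simp at hk1; linarith
    · exact ⟨k - 1, by omega⟩
  have h3 := hk2 l (by omega)
  push Not at h3
  rw [hl] at hk1
  obtain ⟨A, hA1, hA2, hA3⟩ := hZ1 (Z0 + l) (by omega) N h3 (by
    have e : 2 * ((Z0 + l : ℕ) : ℝ) + 2 = 2 * ((Z0 + (l + 1) : ℕ) : ℝ) := by push_cast; ring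
    rw [e]; exact hk1.le)
  exact ⟨A, hA1, fun n hn => by have := hA2 n hn; omega, hA3⟩

/-- Differences of sums over equally many valid indices. -/
def diffGroup (V : ℕ → Prop) (b : ℕ → ℤ) : AddSubgroup ℤ where
  carrier := {z | ∃ S T : Multiset ℕ, (∀ n ∈ S, V n) ∧ (∀ n ∈ T, V n) ∧ S.card = T.card ∧
    (S.map b).sum - (T.map b).sum = z}
  zero_mem' := ⟨0, 0, by simp, by simp, rfl, by simp⟩
  add_mem' := by
    rintro x y ⟨S, T, h1, h2, h3, h4⟩ ⟨S', T', h1', h2', h3', h4'⟩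
    refine ⟨S + S', T + T', ?_, ?_, by simp [h3, h3'], ?_⟩
    · intro n hn; rcases Multiset.mem_add.1 hn with h | h
      · exact h1 n h
      · exact h1' n h
    · intro n hn; rcases Multiset.mem_add.1 hn with h | h
      · exact h2 n h
      · exact h2' n h
    · simp only [Multiset.map_add, Multiset.sum_add]; rw [← h4, ← h4']; ring
  neg_mem' := by
    rintro x ⟨S, T, h1, h2, h3, h4⟩
    exact ⟨T, S, h2, h1, h3.symm, by rw [← h4]; ring⟩

lemma unit_diff {c x0 : ℝ} (hc : 1 ≤ c) {F : ℕ → ℝ → ℝ} (h : DegFam c x0 F) (n1 : ℕ) :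
    ∃ S T : Multiset ℕ, (∀ n ∈ S, n1 ≤ n) ∧ (∀ n ∈ T, n1 ≤ n) ∧ S.card = T.card ∧
      (S.map (fun n : ℕ => ⌊F 0 (n : ℝ)⌋)).sum = (T.map (fun n : ℕ => ⌊F 0 (n : ℝ)⌋)).sum + 1 := by
  set b : ℕ → ℤ := fun n => ⌊F 0 (n : ℝ)⌋ with hb
  obtain ⟨d, hd⟩ := Int.subgroup_cyclic (diffGroup (fun n => n1 ≤ n) b)
  rw [← AddSubgroup.zmultiples_eq_closure] at hd
  have hmem : ∀ n, n1 ≤ n → d ∣ b n - b n1 := by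
    intro n hn
    have : b n - b n1 ∈ diffGroup (fun n => n1 ≤ n) b :=
      ⟨{n}, {n1}, by simpa using hn, by simp, by simp, by simp⟩
    rw [hd] at this
    exact Int.mem_zmultiples_iff.1 this
  have hd1 : d.natAbs = 1 := by
    by_contra hne
    by_cases h0 : d = 0
    · obtain ⟨n, hn, hnd⟩ := floor_not_const_mod hc h 2 le_rfl n1 (b n1)
      have := hmem n hn
      rw [h0, zero_dvd_iff] at this
      apply hnd
      show (2 : ℤ) ∣ b n - b n1
      rw [this]; exact dvd_zero _
    · obtain ⟨n, hn, hnd⟩ := floor_not_const_mod hc h |d| (by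
        rw [Int.abs_eq_natAbs]; omega) n1 (b n1)
      exact hnd ((abs_dvd _ _).2 (hmem n hn))
  have h1 : (1 : ℤ) ∈ diffGroup (fun n => n1 ≤ n) b := by
    rw [hd, Int.mem_zmultiples_iff]
    exact Int.natAbs_dvd.1 (by rw [hd1]; simp)
  obtain ⟨S, T, h2, h3, h4, h5⟩ := h1
  exact ⟨S, T, h2, h3, h4, by linarith⟩

lemma floor_sum_close (A : Multiset ℕ) (f : ℕ → ℝ) :
    (((A.map (fun n => ⌊f n⌋)).sum : ℤ) : ℝ) ≤ (A.map f).sum ∧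
      (A.map f).sum ≤ (((A.map (fun n => ⌊f n⌋)).sum : ℤ) : ℝ) + A.card := by
  induction A using Multiset.induction_on with
  | empty => simp
  | cons a A ih =>
    simp only [Multiset.map_cons, Multiset.sum_cons, Multiset.card_cons]
    rw [Int.cast_add, Nat.cast_add, Nat.cast_one]
    have h1 := Int.floor_le (f a)
    have h2 := Int.lt_floor_add_one (f a)
    constructor <;> linarith [ih.1, ih.2]

lemma basis_mset {c x0 : ℝ} (hc : 1 ≤ c) {F : ℕ → ℝ → ℝ} (h : DegFam c x0 F)
    (hmono : ∃ x2, ∀ x, x2 ≤ x → 0 < F 1 x) (htop : Filter.Tendsto (F 0) Filter.atTop Filter.atTop)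
    (n1 : ℕ) :
    ∃ (t : ℕ) (N0 : ℤ), ∀ N : ℤ, N0 ≤ N → ∃ A : Multiset ℕ, A.card = t ∧ (∀ n ∈ A, n1 ≤ n) ∧
      (A.map (fun n : ℕ => ⌊F 0 (n : ℝ)⌋)).sum = N := by
  obtain ⟨s, G, N0, hsyn⟩ := syndetic_all hc h hmono htop n1
  obtain ⟨S, T, hS, hT, hST, hsum⟩ := unit_diff hc h n1
  set b : ℕ → ℤ := fun n => ⌊F 0 (n : ℝ)⌋ with hb
  obtain ⟨g, hg⟩ := exists_nat_ge G
  -- the floor sum lies in `[N' - g - s, N' + g]`; there are `K = 2 g + s` unit shifts available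
  set K : ℕ := 2 * g + s with hK
  set τ : ℤ := (T.map b).sum with hτ
  refine ⟨s + K * T.card, ⌈N0⌉ + g + K * τ, fun N hN => ?_⟩
  set N' : ℤ := N - g - K * τ with hN'
  obtain ⟨A, hA1, hA2, hA3⟩ := hsyn (N' : ℝ) (by
    have : N0 ≤ (⌈N0⌉ : ℝ) := Int.le_ceil _
    have h2 : ⌈N0⌉ ≤ N' := by omega
    have h3 : ((⌈N0⌉ : ℤ) : ℝ) ≤ (N' : ℝ) := by exact_mod_cast h2
    linarith)
  obtain ⟨h1, h2⟩ := floor_sum_close A (fun n : ℕ => F 0 (n : ℝ))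
  rw [hA1] at h2
  rw [abs_le] at hA3
  set α : ℤ := (A.map b).sum with hα
  have h1' : (α : ℝ) ≤ (A.map (fun n : ℕ => F 0 (n : ℝ))).sum := h1
  have h2' : (A.map (fun n : ℕ => F 0 (n : ℝ))).sum ≤ (α : ℝ) + s := h2
  have hu : α ≤ N' + g := by
    have : (α : ℝ) ≤ (N' : ℝ) + g := by linarith [hA3.1]
    exact_mod_cast this
  have hl : N' - g - s ≤ α := by
    have : (N' : ℝ) - g - s ≤ (α : ℝ) := by linarith [hA3.2]
    exact_mod_cast this
  obtain ⟨i, hi⟩ : ∃ i : ℕ, (i : ℤ) = N' + g - α := ⟨(N' + g - α).toNat, by omega⟩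
  have hiK : i ≤ K := by omega
  obtain ⟨j, hj⟩ : ∃ j : ℕ, i + j = K := ⟨K - i, by omega⟩
  refine ⟨A + (i • S + j • T), ?_, ?_, ?_⟩
  · simp only [Multiset.card_add, Multiset.card_nsmul, hA1, hST, ← hj]
    ring
  · intro n hn
    rcases Multiset.mem_add.1 hn with hn | hn
    · exact hA2 n hn
    rcases Multiset.mem_add.1 hn with hn | hn
    · exact hS n (Multiset.mem_of_mem_nsmul hn)
    · exact hT n (Multiset.mem_of_mem_nsmul hn)
  · simp only [Multiset.map_add, Multiset.sum_add, Multiset.map_nsmul, Multiset.sum_nsmul]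
    rw [hsum, ← hα, ← hτ]
    simp only [nsmul_eq_mul]
    have hj' : (i : ℤ) + j = K := by exact_mod_cast hj
    have : (K : ℤ) * τ = i * τ + j * τ := by rw [← hj']; ring
    have e : (i : ℤ) * (τ + 1) = i * τ + i := by ring
    rw [e]
    omega

theorem stmt_6 (c : ℝ) (hc : 1 ≤ c) (x₀ : ℝ) (hx₀ : 1 ≤ x₀) (f : ℝ → ℝ)
    (hf : ContDiffOn ℝ (⊤ : ℕ∞) f (Set.Ici x₀))
    (htop : Filter.Tendsto f Filter.atTop Filter.atTop)
    (hder : ∀ ε : ℝ, 0 < ε → ∀ j : ℕ, ∃ A B x₁ : ℝ, 0 < A ∧ 0 < B ∧ x₀ ≤ x₁ ∧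
      ∀ x : ℝ, x₁ ≤ x →
        A * x ^ (c - j - ε) ≤ |iteratedDerivWithin j f (Set.Ici x₀) x| ∧
        |iteratedDerivWithin j f (Set.Ici x₀) x| ≤ B * x ^ (c - j + ε)) :
    ∃ t : ℕ, ∃ N₀ : ℤ, ∀ N : ℤ, N₀ ≤ N →
      ∃ n : Fin t → ℕ, (∀ i, x₀ ≤ n i) ∧ ∑ i, ⌊f (n i)⌋ = N := by
  set F : ℕ → ℝ → ℝ := fun j => iteratedDerivWithin j f (Set.Ici x₀) with hF
  have hF0 : F 0 = f := by simp [hF]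
  have hdeg : DegFam c x₀ F := by
    refine ⟨?_, ?_⟩
    · intro i x hx
      have h1 : DifferentiableOn ℝ (iteratedDerivWithin i f (Set.Ici x₀)) (Set.Ici x₀) :=
        hf.differentiableOn_iteratedDerivWithin (by exact_mod_cast WithTop.coe_lt_top _)
          (uniqueDiffOn_Ici x₀)
      have h2 := (h1 x hx.le).hasDerivWithinAt
      rw [← iteratedDerivWithin_succ] at h2
      exact h2.hasDerivAt (Ici_mem_nhds hx)
    · intro ε hε j
      obtain ⟨A, B, x1, hA, hB, _, h⟩ := hder ε hε j
      exact ⟨A, B, x1, hA, hB, h⟩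
  have hmono : ∃ x2, ∀ x, x2 ≤ x → 0 < F 1 x := by
    obtain ⟨x2, h1, h2, h3 | h3⟩ := hdeg.sign 1
    · exact ⟨x2, h3⟩
    · exfalso
      have hanti : AntitoneOn (F 0) (Set.Ici x2) := by
        refine antitoneOn_of_deriv_nonpos (convex_Ici _) ?_ ?_ ?_
        · intro x hx
          exact (hdeg.der 0 x (lt_of_lt_of_le h1 hx)).continuousAt.continuousWithinAt
        · intro x hx
          rw [interior_Ici] at hx
          exact (hdeg.der 0 x (h1.trans hx)).differentiableAt.differentiableWithinAt
        · intro x hx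
          rw [interior_Ici] at hx
          rw [(hdeg.der 0 x (h1.trans hx)).deriv]
          exact (h3 x (le_of_lt hx)).le
      obtain ⟨x, hx1, hx2⟩ := ((htop.eventually_gt_atTop (f x2)).and
        (Filter.eventually_ge_atTop x2)).exists
      have := hanti (Set.mem_Ici.2 le_rfl) hx2 hx2
      rw [hF0] at this
      linarith
  obtain ⟨n1, hn1⟩ := exists_nat_ge x₀
  obtain ⟨t, N0, hN0⟩ := basis_mset hc hdeg hmono (by rw [hF0]; exact htop) n1
  refine ⟨t, N0, fun N hN => ?_⟩
  obtain ⟨A, hA1, hA2, hA3⟩ := hN0 N hN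
  rw [hF0] at hA3
  obtain ⟨l, rfl⟩ : ∃ l : List ℕ, (l : Multiset ℕ) = A := ⟨A.toList, A.coe_toList⟩
  rw [Multiset.coe_card] at hA1
  subst hA1
  refine ⟨fun i => l.get i, fun i => ?_, ?_⟩
  · have : n1 ≤ l.get i := hA2 _ (by simp)
    exact hn1.trans (by exact_mod_cast this)
  · rw [← hA3, Multiset.map_coe, Multiset.sum_coe]
    have := List.sum_ofFn (f := fun i : Fin l.length => ⌊f ((l.get i : ℕ) : ℝ)⌋)
    rw [← this]
    congr 1
    apply List.ext_get <;> simp
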